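/- arXiv:2407.06155 — 2 statements merged into one kernel-verified Lean document; each statement's English description precedes it below -/
import Mathlib

section
/- Let G be a natural unit interval graph on {1,…,n} and for 2 ≤ k ≤ n let b_k denote the number of neighbours i of vertex k with i < k. Then for every 1 ≤ j ≤ n, the sum of q^{inv T} over all fixed points T of φ_G whose top entry is T_1 = j equals q^{j−1} [b_2]_q ⋯ [b_n]_q. -/
open Finset
open scoped Classical

noncomputable section

/-- `G` is a natural unit interval graph. -/
def IsNUIG {n : ℕ} (G : SimpleGraph (Fin n)) : Prop :=
  ∀ i j k : Fin n, i < j → j < k → G.Adj i k → G.Adj i j ∧ G.Adj j k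

/-- A hook-shaped `G`-tableau, encoded by the bijective map sending each entry
`v : Fin n` to its cell `(row, column)` (0-indexed, English notation).
The conditions say: the filling is injective, every cell lies in the first row
or the first column, the occupied cells of the first row and first column form
initial segments (so the shape is a hook diagram `(k, 1^(n-k))`), rows satisfy
(C1): left neighbour `i` of `j` has `i < j` and `ij ∉ E`, and columns satisfy
(C2): upper neighbour `i` of `j` has `i < j` or `ij ∈ E`. -/
def IsHookTab {n : ℕ} (G : SimpleGraph (Fin n))
    (f : Fin n → Fin (n + 1) × Fin (n + 1)) : Prop :=
  Function.Injective f ∧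
  (∀ v, ((f v).1 : ℕ) = 0 ∨ ((f v).2 : ℕ) = 0) ∧
  (∀ v, ((f v).1 : ℕ) = 0 → 0 < ((f v).2 : ℕ) →
    ∃ u, ((f u).1 : ℕ) = 0 ∧ ((f u).2 : ℕ) + 1 = ((f v).2 : ℕ)) ∧
  (∀ v, ((f v).2 : ℕ) = 0 → 0 < ((f v).1 : ℕ) →
    ∃ u, ((f u).2 : ℕ) = 0 ∧ ((f u).1 : ℕ) + 1 = ((f v).1 : ℕ)) ∧
  (∀ u v, ((f u).1 : ℕ) = 0 → ((f v).1 : ℕ) = 0 →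
    ((f v).2 : ℕ) = ((f u).2 : ℕ) + 1 → u < v ∧ ¬ G.Adj u v) ∧
  (∀ u v, ((f u).2 : ℕ) = 0 → ((f v).2 : ℕ) = 0 →
    ((f v).1 : ℕ) = ((f u).1 : ℕ) + 1 → u < v ∨ G.Adj u v)

/-- The entry `v` lies in the arm (first row, excluding the corner cell). -/
def InArm {n : ℕ} (f : Fin n → Fin (n + 1) × Fin (n + 1)) (v : Fin n) : Prop :=
  ((f v).1 : ℕ) = 0 ∧ ((f v).2 : ℕ) ≠ 0

/-- The entry `v` lies in the leg (first column, excluding the corner cell). -/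
def InLeg {n : ℕ} (f : Fin n → Fin (n + 1) × Fin (n + 1)) (v : Fin n) : Prop :=
  ((f v).2 : ℕ) = 0 ∧ ((f v).1 : ℕ) ≠ 0

/-- The set of inversions of a tableau: pairs `(i,j)` with `i < j`, `ij ∈ E`,
and `i` in a lower row than `j`. -/
def InvSet {n : ℕ} (G : SimpleGraph (Fin n))
    (f : Fin n → Fin (n + 1) × Fin (n + 1)) : Finset (Fin n × Fin n) :=
  Finset.univ.filter fun p =>
    p.1 < p.2 ∧ G.Adj p.1 p.2 ∧ ((f p.2).1 : ℕ) < ((f p.1).1 : ℕ)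

/-- `g` is obtained from `f` by moving the entry `j` (between the arm and leg),
keeping all other entries in their regions and relative order, so that `g` is
again a `G`-tableau with the same inversion set. -/
def MoveCore {n : ℕ} (G : SimpleGraph (Fin n))
    (f g : Fin n → Fin (n + 1) × Fin (n + 1)) (j : Fin n) : Prop :=
  IsHookTab G g ∧
  (∀ u, u ≠ j → ((InArm f u ↔ InArm g u) ∧ (InLeg f u ↔ InLeg g u))) ∧
  (∀ u u', u ≠ j → u' ≠ j → InArm f u → InArm f u' →
    (((f u).2 : ℕ) < ((f u').2 : ℕ) ↔ ((g u).2 : ℕ) < ((g u').2 : ℕ))) ∧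
  (∀ u u', u ≠ j → u' ≠ j → InLeg f u → InLeg f u' →
    (((f u).1 : ℕ) < ((f u').1 : ℕ) ↔ ((g u).1 : ℕ) < ((g u').1 : ℕ))) ∧
  InvSet G g = InvSet G f

/-- `g` is the result of moving the arm entry `j` of `f` to the leg. -/
def ArmToLeg {n : ℕ} (G : SimpleGraph (Fin n))
    (f g : Fin n → Fin (n + 1) × Fin (n + 1)) (j : Fin n) : Prop :=
  InArm f j ∧ InLeg g j ∧ MoveCore G f g j

/-- `g` is the result of moving the leg entry `j` of `f` to the arm. -/
def LegToArm {n : ℕ} (G : SimpleGraph (Fin n))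
    (f g : Fin n → Fin (n + 1) × Fin (n + 1)) (j : Fin n) : Prop :=
  InLeg f j ∧ InArm g j ∧ MoveCore G f g j

/-- The entry `j` is movable. -/
def MovableEntry {n : ℕ} (G : SimpleGraph (Fin n))
    (f : Fin n → Fin (n + 1) × Fin (n + 1)) (j : Fin n) : Prop :=
  (∃ g, ArmToLeg G f g j) ∨ (∃ g, LegToArm G f g j)

/-- `HT n G`: the type of hook-shaped `G`-tableaux. -/
abbrev HT (n : ℕ) (G : SimpleGraph (Fin n)) :=
  {f : Fin n → Fin (n + 1) × Fin (n + 1) // IsHookTab G f}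

lemma MovableEntry.exists_tab {n : ℕ} {G : SimpleGraph (Fin n)}
    {f : Fin n → Fin (n + 1) × Fin (n + 1)} {j : Fin n} (h : MovableEntry G f j) :
    ∃ g, IsHookTab G g ∧ (ArmToLeg G f g j ∨ LegToArm G f g j) := by
  rcases h with ⟨g, hg⟩ | ⟨g, hg⟩
  · exact ⟨g, hg.2.2.1, Or.inl hg⟩
  · exact ⟨g, hg.2.2.1, Or.inr hg⟩

/-- The involution `φ_G`: if `T` has a movable entry, move the smallest movable
entry `j` (producing `T^j`); otherwise fix `T`. -/
noncomputable def phi {n : ℕ} {G : SimpleGraph (Fin n)} (T : HT n G) : HT n G :=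
  if h : (Finset.univ.filter fun j : Fin n => MovableEntry G T.1 j).Nonempty then
    have hj : MovableEntry G T.1
        ((Finset.univ.filter fun j : Fin n => MovableEntry G T.1 j).min' h) :=
      (Finset.mem_filter.mp (Finset.min'_mem _ h)).2
    ⟨Classical.choose hj.exists_tab, (Classical.choose_spec hj.exists_tab).1⟩
  else T

/-- The number of arm entries of `T`; the shape of `T` is `(k, 1^(n-k))` with
`k = armCard T + 1`. -/
def armCard {n : ℕ} {G : SimpleGraph (Fin n)} (T : HT n G) : ℕ :=
  (Finset.univ.filter fun v => InArm T.1 v).card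

/-- The sign `(-1)^(k-1)` of a hook tableau of shape `(k, 1^(n-k))`. -/
def tabSign {n : ℕ} {G : SimpleGraph (Fin n)} (T : HT n G) : ℤ :=
  (-1) ^ armCard T

/-- The number of inversions of `T`. -/
def tabInv {n : ℕ} (G : SimpleGraph (Fin n)) (T : HT n G) : ℕ :=
  (InvSet G T.1).card

/-- The `q`-integer `[k]_q = 1 + q + ⋯ + q^(k-1)` in `ℤ[q]`. -/
def qInt (k : ℕ) : Polynomial ℤ := ∑ i ∈ Finset.range k, Polynomial.X ^ i

/-- `b_k`: the number of neighbours of `k` smaller than `k`. -/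
def smallerNbrs {n : ℕ} (G : SimpleGraph (Fin n)) (k : Fin n) : ℕ :=
  (Finset.univ.filter fun i : Fin n => i < k ∧ G.Adj i k).card

/-- `r` is an orientation of `G`: every arc is an edge and every edge gets
exactly one direction. -/
def IsOrientation {V : Type*} (G : SimpleGraph V) (r : V → V → Prop) : Prop :=
  (∀ u v, r u v → G.Adj u v) ∧ (∀ u v, G.Adj u v → (r u v ↔ ¬ r v u))

/-- `r` is an acyclic orientation of `G`. -/
def IsAcyclicOrientation {V : Type*} (G : SimpleGraph V) (r : V → V → Prop) : Prop :=
  IsOrientation G r ∧ ∀ v, ¬ Relation.TransGen r v v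

/-- `v` is a sink: it has no outgoing arc. -/
def IsSinkOf {V : Type*} (r : V → V → Prop) (v : V) : Prop := ∀ u, ¬ r v u

/-- `f` is a `G`-tableau of column shape `1^n`. -/
def IsColTab {n : ℕ} (G : SimpleGraph (Fin n))
    (f : Fin n → Fin (n + 1) × Fin (n + 1)) : Prop :=
  IsHookTab G f ∧ ∀ v, ((f v).2 : ℕ) = 0

/-- The orientation `ψ(T)` associated to a column tableau: each edge is directed
from the entry occurring lower in `T` to the entry occurring higher. -/
def psi {n : ℕ} (G : SimpleGraph (Fin n))
    (f : Fin n → Fin (n + 1) × Fin (n + 1)) : Fin n → Fin n → Prop :=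
  fun u v => G.Adj u v ∧ ((f v).1 : ℕ) < ((f u).1 : ℕ)

end

section ListPart

/-- every entry of the list has a neighbour in `S` or earlier in the list -/
def Conn (A : ℕ → ℕ → Prop) : Set ℕ → List ℕ → Prop
  | _, [] => True
  | S, v :: l => (∃ u ∈ S, A u v) ∧ Conn A (insert v S) l

/-- inversions of a word -/
noncomputable def linv (A : ℕ → ℕ → Prop) : List ℕ → ℕ
  | [] => 0
  | a :: l => l.countP (fun b => decide (b < a ∧ A b a)) + linv A l

lemma Conn_append (A : ℕ → ℕ → Prop) (l1 l2 : List ℕ) : ∀ S : Set ℕ,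
    Conn A S (l1 ++ l2) ↔ Conn A S l1 ∧ Conn A (S ∪ {x | x ∈ l1}) l2 := by
  induction l1 with
  | nil => intro S; simp [Conn]
  | cons a l ih =>
    intro S
    simp only [List.cons_append, Conn, ih, and_assoc]
    have : insert a S ∪ {x | x ∈ l} = S ∪ {x | x ∈ a :: l} := by
      ext x; simp; tauto
    rw [this]

lemma Conn_insert (A : ℕ → ℕ → Prop) (m : ℕ) (l : List ℕ) : ∀ (S : Set ℕ),
    (∀ v ∈ l, A m v → ∃ u ∈ S, A u v) → (Conn A (insert m S) l ↔ Conn A S l) := by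
  induction l with
  | nil => intro S _; simp [Conn]
  | cons a l ih =>
    intro S h
    simp only [Conn]
    rw [Set.insert_comm, ih (insert a S)]
    · have := h a (by simp)
      refine and_congr_left fun _ => ?_
      constructor
      · rintro ⟨u, hu, hA⟩
        rcases hu with rfl | hu
        · exact this hA
        · exact ⟨u, hu, hA⟩
      · rintro ⟨u, hu, hA⟩
        exact ⟨u, Or.inr hu, hA⟩
    · intro v hv hA
      obtain ⟨u, hu, h'⟩ := h v (by simp [hv]) hA
      exact ⟨u, Or.inr hu, h'⟩

lemma linv_insert (A : ℕ → ℕ → Prop) (m : ℕ) (l2 : List ℕ) (h2 : ∀ x ∈ l2, x < m) :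
    ∀ l1 : List ℕ, (∀ x ∈ l1, x < m) →
    linv A (l1 ++ m :: l2) = linv A (l1 ++ l2) + l2.countP (fun b => decide (A b m)) := by
  intro l1
  induction l1 with
  | nil =>
    intro _
    simp only [List.nil_append, linv]
    rw [add_comm]; congr 1
    apply List.countP_congr
    intro x hx; simp [h2 x hx]
  | cons a l ih =>
    intro h
    simp only [List.cons_append, linv]
    rw [ih (fun x hx => h x (by simp [hx]))]
    have : ¬ m < a := by have := h a (by simp); omega
    simp [List.countP_append, List.countP_cons, this]
    omega

/-- the words -/
def WP (A : ℕ → ℕ → Prop) (m j : ℕ) (l : List ℕ) : Prop :=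
  l.Perm (List.range m) ∧ l.IsChain (fun u v => u < v ∨ A u v) ∧
    ∃ t, l = j :: t ∧ Conn A {j} t

noncomputable def WW (A : ℕ → ℕ → Prop) (m j : ℕ) : Finset (List ℕ) :=
  (List.range m).permutations.toFinset.filter (WP A m j)

lemma mem_WW (A : ℕ → ℕ → Prop) (m j : ℕ) (l : List ℕ) : l ∈ WW A m j ↔ WP A m j l := by
  simp only [WW, Finset.mem_filter, List.mem_toFinset, List.mem_permutations, WP]
  tauto

lemma perm_split (m : ℕ) (l1 l2 : List ℕ) :
    (l1 ++ m :: l2).Perm (List.range (m+1)) ↔ (l1 ++ l2).Perm (List.range m) := by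
  have h1 : (l1 ++ m :: l2).Perm (m :: (l1 ++ l2)) := List.perm_middle
  have h2 : (List.range (m+1)).Perm (m :: List.range m) := by
    rw [List.range_succ]; exact List.perm_append_singleton _ _
  constructor
  · intro h
    exact (List.perm_cons m).1 (h1.symm.trans (h.trans h2))
  · intro h
    exact h1.trans (((List.perm_cons m).2 h).trans h2.symm)

lemma chain_split (A : ℕ → ℕ → Prop) (hs : ∀ u v, A u v → A v u)
    (hA : ∀ i j k, i < j → j < k → A i k → A i j ∧ A j k)
    (m : ℕ) (l1 l2 : List ℕ) (h1 : ∀ x ∈ l1, x < m) (h2 : ∀ x ∈ l2, x < m)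
    (hnd : ∀ x ∈ l1, x ∉ l2) :
    (l1 ++ m :: l2).IsChain (fun u v => u < v ∨ A u v) ↔
      (l1 ++ l2).IsChain (fun u v => u < v ∨ A u v) ∧ (∀ x ∈ l2.head?, A x m) := by
  rw [List.isChain_append, List.isChain_append, List.isChain_cons]
  constructor
  · rintro ⟨a, ⟨b, c⟩, d⟩
    have key : ∀ x ∈ l2.head?, A x m := by
      intro x hx
      have hlt := h2 x (List.mem_of_mem_head? hx)
      rcases b x hx with h | h
      · omega
      · exact hs _ _ h
    refine ⟨⟨a, c, ?_⟩, key⟩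
    intro x hx y hy
    by_contra hcon
    push Not at hcon
    have hxm := h1 x (List.mem_of_mem_getLast? hx)
    have hym := key y hy
    rcases Nat.lt_or_ge y x with h | h
    · exact hcon.2 (hs _ _ (hA y x m h hxm hym).1)
    · have hxy : x = y := by omega
      subst hxy
      exact hnd x (List.mem_of_mem_getLast? hx) (List.mem_of_mem_head? hy)
  · rintro ⟨⟨a, b, c⟩, d⟩
    refine ⟨a, ⟨fun y hy => Or.inr (hs _ _ (d y hy)), b⟩, ?_⟩
    intro x hx y hy
    simp at hy
    subst hy
    exact Or.inl (h1 x (List.mem_of_mem_getLast? hx))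


lemma exists_split (p : ℕ → Bool) : ∀ (l : List ℕ) (k : ℕ), k ≤ l.countP p →
    ∃ l1 l2, l = l1 ++ l2 ∧ l2.countP p = k ∧ ∀ x ∈ l2.head?, p x = true := by
  intro l
  induction l with
  | nil => intro k hk; exact ⟨[], [], by simp, by simp at hk ⊢; omega, by simp⟩
  | cons a l ih =>
    intro k hk
    by_cases h : k ≤ l.countP p
    · obtain ⟨l1, l2, h1, h2, h3⟩ := ih k h
      exact ⟨a :: l1, l2, by simp [h1], h2, h3⟩
    · rw [List.countP_cons] at hk
      by_cases hp : p a = true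
      · refine ⟨[], a :: l, rfl, ?_, by simp [hp]⟩
        rw [List.countP_cons]; simp [hp] at hk ⊢; omega
      · simp [hp] at hk; omega

lemma unique_split (p : ℕ → Bool) (l1 l2 r1 r2 : List ℕ) (h : l1 ++ l2 = r1 ++ r2)
    (hc : l2.countP p = r2.countP p) (hl : ∀ x ∈ l2.head?, p x = true)
    (hr : ∀ x ∈ r2.head?, p x = true) : l1 = r1 ∧ l2 = r2 := by
  rcases List.append_eq_append_iff.1 h with ⟨a, rfl, rfl⟩ | ⟨a, rfl, rfl⟩
  · cases a with
    | nil => simp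
    | cons x a =>
      have := hl x (by simp)
      simp [List.countP_append, List.countP_cons, this] at hc
      omega
  · cases a with
    | nil => simp
    | cons x a =>
      have := hr x (by simp)
      simp [List.countP_append, List.countP_cons, this] at hc
      omega

noncomputable def bb (A : ℕ → ℕ → Prop) (m : ℕ) : ℕ := ((Finset.range m).filter (fun i => A i m)).card

lemma countP_perm_range (A : ℕ → ℕ → Prop) (m : ℕ) (l : List ℕ) (h : l.Perm (List.range m)) :
    l.countP (fun b => decide (A b m)) = bb A m := by
  rw [h.countP_eq, bb, List.countP_eq_length_filter]
  rfl

lemma WP_split (A : ℕ → ℕ → Prop) (hs : ∀ u v, A u v → A v u)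
    (hA : ∀ i j k, i < j → j < k → A i k → A i j ∧ A j k)
    (m j : ℕ) (hj : j < m) (l1 l2 : List ℕ) :
    WP A (m+1) j (l1 ++ m :: l2) ↔ WP A m j (l1 ++ l2) ∧ (∀ x ∈ l2.head?, A x m) ∧ 
      ∃ u ∈ l1, A u m := by
  unfold WP
  rw [perm_split]
  by_cases hp : (l1 ++ l2).Perm (List.range m)
  swap
  · simp [hp]
  have hlt : ∀ x ∈ l1 ++ l2, x < m := fun x hx => by simpa using hp.mem_iff.1 hx
  have h1 : ∀ x ∈ l1, x < m := fun x hx => hlt x (by simp [hx])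
  have h2 : ∀ x ∈ l2, x < m := fun x hx => hlt x (by simp [hx])
  have hnd : (l1 ++ l2).Nodup := hp.nodup_iff.2 List.nodup_range
  have hdis : ∀ x ∈ l1, x ∉ l2 := fun x hx hx' => by
    rw [List.nodup_append] at hnd
    exact hnd.2.2 x hx x hx' rfl
  rw [chain_split A hs hA m l1 l2 h1 h2 hdis]
  simp only [hp, true_and, and_assoc]
  refine and_congr_right fun hch => ?_
  cases l1 with
  | nil =>
    simp
    intro h; omega
  | cons a t =>
    simp only [List.cons_append, List.cons.injEq]
    have e1 : (∃ t_1, (a = j ∧ t ++ m :: l2 = t_1) ∧ Conn A {j} t_1) ↔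
      (a = j ∧ Conn A {j} (t ++ m :: l2)) := by
      constructor
      · rintro ⟨_, ⟨h, rfl⟩, h'⟩; exact ⟨h, h'⟩
      · rintro ⟨h, h'⟩; exact ⟨_, ⟨h, rfl⟩, h'⟩
    have e2 : (∃ t_1, (a = j ∧ t ++ l2 = t_1) ∧ Conn A {j} t_1) ↔
      (a = j ∧ Conn A {j} (t ++ l2)) := by
      constructor
      · rintro ⟨_, ⟨h, rfl⟩, h'⟩; exact ⟨h, h'⟩
      · rintro ⟨h, h'⟩; exact ⟨_, ⟨h, rfl⟩, h'⟩
    rw [e1, e2]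
    have key : a = j → (Conn A {j} (t ++ m :: l2) ↔
        (Conn A {j} (t ++ l2) ∧ ∃ u ∈ a :: t, A u m)) := by
      rintro rfl
      rw [Conn_append, Conn_append, Conn]
      have hS : (∃ u ∈ ({a} ∪ {x | x ∈ t} : Set ℕ), A u m) ↔ ∃ u ∈ a :: t, A u m := by
        simp
      rw [hS, and_assoc]
      refine and_congr_right fun _ => ?_
      rw [and_comm]
      refine and_congr_left ?_
      rintro ⟨u, hu, hum⟩
      apply Conn_insert
      intro v hv hmv
      refine ⟨u, by simpa using hu, ?_⟩
      have hne : u ≠ v := fun h => hdis u hu (h ▸ hv)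
      have hvm := hs _ _ hmv
      have := h1 u hu
      have := h2 v hv
      rcases lt_or_gt_of_ne hne with h | h
      · exact (hA u v m h (by omega) hum).1
      · exact hs _ _ (hA v u m h (by omega) hvm).1
    by_cases haj : a = j
    · have k := key haj
      rw [k]; tauto
    · tauto

lemma sum_step_lt (A : ℕ → ℕ → Prop) (hs : ∀ u v, A u v → A v u) (hi : ∀ u, ¬ A u u)
    (hA : ∀ i j k, i < j → j < k → A i k → A i j ∧ A j k)
    (m j : ℕ) (hj : j < m) :
    ∑ l ∈ WW A (m+1) j, (Polynomial.X : Polynomial ℤ) ^ linv A l =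
      (∑ l ∈ WW A m j, (Polynomial.X : Polynomial ℤ) ^ linv A l) * qInt (bb A m) := by
  rw [qInt, Finset.sum_mul_sum, ← Finset.sum_product']
  have split : ∀ l, WP A (m+1) j l → ∃ l1 l2, l = l1 ++ m :: l2 ∧ m ∉ l1 := by
    intro l hl
    have : m ∈ l := hl.1.mem_iff.2 (by simp)
    obtain ⟨l1, l2, h, h'⟩ := List.eq_append_cons_of_mem this
    exact ⟨l1, l2, h, h'⟩
  have ev : ∀ l1 l2 : List ℕ, m ∉ l1 → ((l1 ++ m :: l2).erase m,
      ((l1 ++ m :: l2).dropWhile (fun x => decide (x ≠ m))).countP (fun b => decide (A b m))) =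
      (l1 ++ l2, l2.countP (fun b => decide (A b m))) := by
    intro l1 l2 h
    rw [List.erase_append_right _ h, List.dropWhile_append_of_pos]
    · simp [List.dropWhile_cons, List.countP_cons, hi]
    · intro a ha
      simp
      rintro rfl; exact h ha
  refine Finset.sum_nbij (fun l => (l.erase m,
      (l.dropWhile (fun x => decide (x ≠ m))).countP (fun b => decide (A b m)))) ?_ ?_ ?_ ?_
  · intro l hl
    rw [mem_WW] at hl
    obtain ⟨l1, l2, rfl, hm⟩ := split l hl
    rw [WP_split A hs hA m j hj] at hl
    rw [ev l1 l2 hm, Finset.mem_product, mem_WW]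
    refine ⟨hl.1, ?_⟩
    simp only [Finset.mem_range]
    rw [← countP_perm_range A m _ hl.1.1, List.countP_append]
    obtain ⟨u, hu, hum⟩ := hl.2.2
    have : 0 < l1.countP (fun b => decide (A b m)) := by
      rw [List.countP_pos_iff]; exact ⟨u, hu, by simpa using hum⟩
    omega
  · intro l hl r hr he
    rw [Finset.mem_coe, mem_WW] at hl hr
    obtain ⟨l1, l2, rfl, hm⟩ := split l hl
    obtain ⟨r1, r2, rfl, hm'⟩ := split r hr
    rw [WP_split A hs hA m j hj] at hl hr
    simp only [] at he
    rw [ev l1 l2 hm, ev r1 r2 hm', Prod.mk.injEq] at he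
    obtain ⟨h1, h2⟩ := unique_split _ _ _ _ _ he.1 he.2 (by simpa using hl.2.1) (by simpa using hr.2.1)
    rw [h1, h2]
  · rintro ⟨w, k⟩ hw
    rw [Finset.mem_coe, Finset.mem_product, mem_WW, Finset.mem_range] at hw
    simp only [] at hw
    have hcp := countP_perm_range A m _ hw.1.1
    obtain ⟨l1, l2, rfl, h2, h3⟩ := exists_split (fun b => decide (A b m)) w k (by omega)
    have hm : m ∉ l1 := fun h => by
      have := hw.1.1.mem_iff.1 (List.mem_append_left l2 h)
      simp at this
    refine ⟨l1 ++ m :: l2, ?_, ?_⟩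
    · rw [Finset.mem_coe, mem_WW, WP_split A hs hA m j hj]
      refine ⟨hw.1, by simpa using h3, ?_⟩
      have : 0 < l1.countP (fun b => decide (A b m)) := by
        rw [List.countP_append] at hcp; omega
      rw [List.countP_pos_iff] at this
      simpa using this
    · simp only []
      rw [ev l1 l2 hm, h2]
  · intro l hl
    rw [mem_WW] at hl
    obtain ⟨l1, l2, rfl, hm⟩ := split l hl
    rw [WP_split A hs hA m j hj] at hl
    have hlt : ∀ x ∈ l1 ++ l2, x < m := fun x hx => by simpa using hl.1.1.mem_iff.1 hx
    simp only []
    have := ev l1 l2 hm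
    rw [Prod.mk.injEq] at this
    rw [this.1, this.2, linv_insert, pow_add]
    · intro x hx; exact hlt x (by simp [hx])
    · intro x hx; exact hlt x (by simp [hx])

lemma WP_top (A : ℕ → ℕ → Prop) (hs : ∀ u v, A u v → A v u)
    (hA : ∀ i j k, i < j → j < k → A i k → A i j ∧ A j k)
    (m : ℕ) (hm : 0 < m) (l : List ℕ) :
    WP A (m+1) m (m :: l) ↔ ∃ u, u < m ∧ A u m ∧ WP A m u l := by
  unfold WP
  have h0 := perm_split m [] l
  simp only [List.nil_append] at h0
  rw [h0]
  by_cases hp : l.Perm (List.range m)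
  swap
  · simp [hp]
  have hlt : ∀ x ∈ l, x < m := fun x hx => by simpa using hp.mem_iff.1 hx
  have hnd : l.Nodup := hp.nodup_iff.2 List.nodup_range
  have hch := chain_split A hs hA m [] l (by simp) hlt (by simp)
  simp only [List.nil_append] at hch
  rw [hch]
  cases l with
  | nil => simp at hp; omega
  | cons a t =>
    have ha : a < m := hlt a (by simp)
    have key : A a m → (Conn A {m} (a :: t) ↔ Conn A {a} t) := by
      intro ham
      rw [Conn]
      have e : (insert a {m} : Set ℕ) = insert m {a} := by
        ext x; simp; tauto
      rw [e, Conn_insert]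
      · simp [hs _ _ ham]
      · intro v hv hmv
        have hne : a ≠ v := by
          rintro rfl; simp at hnd; exact hnd.1 hv
        refine ⟨a, rfl, ?_⟩
        have := hlt v (by simp [hv])
        rcases lt_or_gt_of_ne hne with h | h
        · exact (hA a v m h (by omega) ham).1
        · exact hs _ _ (hA v a m h (by omega) (hs _ _ hmv)).1
    constructor
    · rintro ⟨-, ⟨h1, h2⟩, t', h3, h4⟩
      have ham := h2 a (by simp)
      simp at h3
      subst h3
      exact ⟨a, ha, ham, hp, h1, t, rfl, (key ham).1 h4⟩
    · rintro ⟨u, hu, hum, -, h1, t', h3, h4⟩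
      simp at h3
      obtain ⟨rfl, rfl⟩ := h3
      exact ⟨hp, ⟨h1, by simpa using hum⟩, _, rfl, (key hum).2 h4⟩

lemma sum_step_top (A : ℕ → ℕ → Prop) (hs : ∀ u v, A u v → A v u)
    (hA : ∀ i j k, i < j → j < k → A i k → A i j ∧ A j k)
    (m : ℕ) (hm : 0 < m) :
    ∑ l ∈ WW A (m+1) m, (Polynomial.X : Polynomial ℤ) ^ linv A l =
      ∑ u ∈ (Finset.range m).filter (fun i => A i m), Polynomial.X ^ (bb A m) * 
       ∑ l ∈ WW A m u, (Polynomial.X : Polynomial ℤ) ^ linv A l := by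
  simp_rw [Finset.mul_sum]
  rw [Finset.sum_sigma']
  symm
  refine Finset.sum_nbij (fun x => m :: x.2) ?_ ?_ ?_ ?_
  · rintro ⟨u, l⟩ h
    simp only [Finset.mem_sigma, mem_WW, Finset.mem_filter, Finset.mem_range] at h ⊢
    rw [WP_top A hs hA m hm]
    exact ⟨u, h.1.1, h.1.2, h.2⟩
  · rintro ⟨u, l⟩ h ⟨u', l'⟩ h' he
    simp only [Finset.mem_coe, Finset.mem_sigma, mem_WW, Finset.mem_filter, Finset.mem_range] at h h'
    simp at he
    subst he
    obtain ⟨t, ht, -⟩ := h.2.2.2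
    obtain ⟨t', ht', -⟩ := h'.2.2.2
    rw [ht] at ht'
    simp at ht'
    simp [ht'.1]
  · intro l hl
    rw [Finset.mem_coe, mem_WW] at hl
    obtain ⟨t, rfl, -⟩ := hl.2.2
    rw [WP_top A hs hA m hm] at hl
    obtain ⟨u, h1, h2, h3⟩ := hl
    refine ⟨⟨u, t⟩, ?_, rfl⟩
    simp only [Finset.mem_coe, Finset.mem_sigma, mem_WW, Finset.mem_filter, Finset.mem_range]
    exact ⟨⟨h1, h2⟩, h3⟩
  · rintro ⟨u, l⟩ h
    simp only [Finset.mem_sigma, mem_WW] at h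
    have hlt : ∀ x ∈ l, x < m := fun x hx => by simpa using h.2.1.mem_iff.1 hx
    have := linv_insert A m l hlt [] (by simp)
    simp only [List.nil_append] at this
    simp only []
    rw [this, countP_perm_range A m l h.2.1, pow_add, mul_comm]

lemma filter_eq_Ico (A : ℕ → ℕ → Prop)
    (hA : ∀ i j k, i < j → j < k → A i k → A i j ∧ A j k) (m : ℕ) :
    (Finset.range m).filter (fun i => A i m) = Finset.Ico (m - bb A m) m := by
  rcases Finset.eq_empty_or_nonempty ((Finset.range m).filter (fun i => A i m)) with h | h
  · have : bb A m = 0 := by rw [bb, h]; rfl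
    rw [this, h]; simp
  · set a := ((Finset.range m).filter (fun i => A i m)).min' h with ha
    have ham := Finset.min'_mem _ h
    rw [← ha] at ham
    simp only [Finset.mem_filter, Finset.mem_range] at ham
    have e : (Finset.range m).filter (fun i => A i m) = Finset.Ico a m := by
      ext x
      simp only [Finset.mem_filter, Finset.mem_range, Finset.mem_Ico]
      constructor
      · intro hx
        exact ⟨Finset.min'_le _ _ (by simpa using hx), hx.1⟩
      · rintro ⟨h1, h2⟩
        refine ⟨h2, ?_⟩
        rcases h1.lt_or_eq with h3 | h3
        · exact (hA a x m h3 h2 ham.2).2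
        · rw [← h3]; exact ham.2
    have : bb A m = m - a := by rw [bb, e]; simp
    rw [e, this]
    congr 1; omega

theorem list_main (A : ℕ → ℕ → Prop) (hs : ∀ u v, A u v → A v u) (hi : ∀ u, ¬ A u u)
    (hA : ∀ i j k, i < j → j < k → A i k → A i j ∧ A j k) (m : ℕ) : ∀ j, j < m →
    ∑ l ∈ WW A m j, (Polynomial.X : Polynomial ℤ) ^ linv A l =
      Polynomial.X ^ j * ∏ k ∈ Finset.Ico 1 m, qInt (bb A k) := by
  induction m with
  | zero => intro j hj; omega
  | succ m ih =>
    intro j hj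
    rcases Nat.eq_zero_or_pos m with rfl | hm
    · have : j = 0 := by omega
      subst this
      have : WW A 1 0 = {[0]} := by
        ext l
        rw [mem_WW, Finset.mem_singleton]
        constructor
        · intro h; simpa using h.1
        · rintro rfl
          exact ⟨by simp, by simp, [], rfl, trivial⟩
      simp [this, linv]
    · rw [Finset.prod_Ico_succ_top (by omega)]
      rcases Nat.lt_or_ge j m with h | h
      · rw [sum_step_lt A hs hi hA m j h, ih j h, mul_assoc]
      · have : j = m := by omega
        subst this
        rw [sum_step_top A hs hA j hm]
        rw [Finset.sum_congr rfl (g := fun u => (Polynomial.X ^ bb A j * ∏ k ∈ Finset.Ico 1 j, qInt (bb A k)) * Polynomial.X ^ u)]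
        · rw [← Finset.mul_sum, filter_eq_Ico A hA, Finset.sum_Ico_eq_sum_range]
          have hle : bb A j ≤ j := by
            rw [bb]; exact (Finset.card_filter_le _ _).trans (by simp)
          rw [show j - (j - bb A j) = bb A j by omega]
          simp_rw [pow_add]
          rw [← Finset.mul_sum, ← qInt]
          have : (Polynomial.X : Polynomial ℤ) ^ j = Polynomial.X ^ bb A j * Polynomial.X ^ (j - bb A j) := by
            rw [← pow_add]; congr 1; omega
          rw [this]; ring
        · intro u hu
          simp at hu
          rw [ih u hu.1]; ring

end ListPart
section TabPart

variable {n : ℕ} {G : SimpleGraph (Fin n)}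

lemma phi_fixed_iff (T : HT n G) : phi T = T ↔ ∀ j, ¬ MovableEntry G T.1 j := by
  by_cases h : (Finset.univ.filter fun j : Fin n => MovableEntry G T.1 j).Nonempty
  · have hj : MovableEntry G T.1
        ((Finset.univ.filter fun j : Fin n => MovableEntry G T.1 j).min' h) :=
      (Finset.mem_filter.mp (Finset.min'_mem _ h)).2
    have e : phi T = ⟨Classical.choose hj.exists_tab, (Classical.choose_spec hj.exists_tab).1⟩ := by
      unfold phi
      rw [dif_pos h]
    constructor
    · intro he
      exfalso
      have hsp := (Classical.choose_spec hj.exists_tab).2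
      have : Classical.choose hj.exists_tab = T.1 := by
        rw [e] at he
        exact congrArg Subtype.val he
      rw [this] at hsp
      rcases hsp with h | h
      · exact h.2.1.2 h.1.1
      · exact h.1.2 h.2.1.1
    · intro hn
      exact absurd hj (hn _)
  · constructor
    · intro _ j hj
      exact h ⟨j, by simpa using hj⟩
    · intro _
      unfold phi
      rw [dif_neg h]

/-- convenience constructor for cells -/
def cell (n a b : ℕ) (ha : a < n + 1) (hb : b < n + 1) : Fin (n+1) × Fin (n+1) := (⟨a, ha⟩, ⟨b, hb⟩)

lemma IsHookTab.inj' {f : Fin n → Fin (n + 1) × Fin (n + 1)} (hf : IsHookTab G f) {u v : Fin n}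
    (h1 : ((f u).1 : ℕ) = (f v).1) (h2 : ((f u).2 : ℕ) = (f v).2) : u = v :=
  hf.1 (Prod.ext (Fin.ext h1) (Fin.ext h2))

lemma row_filled {f : Fin n → Fin (n + 1) × Fin (n + 1)} (hf : IsHookTab G f) (v : Fin n)
    (hv : ((f v).2 : ℕ) = 0) : ∀ d r, r + d = ((f v).1 : ℕ) →
    ∃ u, ((f u).2 : ℕ) = 0 ∧ ((f u).1 : ℕ) = r := by
  intro d
  induction d with
  | zero => intro r hr; exact ⟨v, hv, by omega⟩
  | succ d ih =>
    intro r hr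
    obtain ⟨u, h1, h2⟩ := ih (r+1) (by omega)
    obtain ⟨w, h3, h4⟩ := hf.2.2.2.1 u h1 (by omega)
    exact ⟨w, h3, by omega⟩

lemma row_lt {f : Fin n → Fin (n + 1) × Fin (n + 1)} (hf : IsHookTab G f) (v : Fin n)
    (hv : ((f v).2 : ℕ) = 0) : 
    ((f v).1 : ℕ) + 1 ≤ (Finset.univ.filter (fun u : Fin n => ((f u).2 : ℕ) = 0)).card := by
  rw [← Finset.card_range (((f v).1 : ℕ) + 1)]
  have : Finset.range (((f v).1 : ℕ) + 1) ⊆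
    (Finset.univ.filter (fun u : Fin n => ((f u).2 : ℕ) = 0)).image (fun u => ((f u).1 : ℕ)) := by
    intro r hr
    simp only [Finset.mem_range] at hr
    obtain ⟨u, h1, h2⟩ := row_filled hf v hv (((f v).1 : ℕ) - r) r (by omega)
    simp only [Finset.mem_image, Finset.mem_filter, Finset.mem_univ, true_and]
    exact ⟨u, h1, h2⟩
  exact (Finset.card_le_card this).trans Finset.card_image_le

lemma row_lt_n {f : Fin n → Fin (n + 1) × Fin (n + 1)} (hf : IsHookTab G f) (v : Fin n)
    (hv : ((f v).2 : ℕ) = 0) : ((f v).1 : ℕ) < n := by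
  have := row_lt hf v hv
  have h2 := Finset.card_filter_le (Finset.univ : Finset (Fin n)) (fun u : Fin n => ((f u).2 : ℕ) = 0)
  simp only [Finset.card_univ, Fintype.card_fin] at h2
  omega

lemma row_lt_n' {f : Fin n → Fin (n + 1) × Fin (n + 1)} (hf : IsHookTab G f) (v j : Fin n)
    (hv : ((f v).2 : ℕ) = 0) (hj : ((f j).2 : ℕ) ≠ 0) : ((f v).1 : ℕ) + 1 < n := by
  have := row_lt hf v hv
  have h2 : (Finset.univ.filter (fun u : Fin n => ((f u).2 : ℕ) = 0)).card < 
    (Finset.univ : Finset (Fin n)).card := by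
    apply Finset.card_lt_card
    rw [Finset.filter_ssubset]
    exact ⟨j, by simp, hj⟩
  simp only [Finset.card_univ, Fintype.card_fin] at h2
  omega

/-- in the first row, every entry but the corner is non-adjacent to and bigger than the corner -/
lemma corner_lt (hG : IsNUIG G) {f : Fin n → Fin (n + 1) × Fin (n + 1)} (hf : IsHookTab G f) (c : Fin n)
    (hc1 : ((f c).1 : ℕ) = 0) :
    ∀ k (j : Fin n), ((f j).1 : ℕ) = 0 → ((f j).2 : ℕ) = (f c).2 + k + 1 →
      c < j ∧ ¬ G.Adj c j := by
  intro k
  induction k with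
  | zero => intro j h1 h2; exact hf.2.2.2.2.1 c j hc1 h1 (by omega)
  | succ k ih =>
    intro j h1 h2
    obtain ⟨u, h3, h4⟩ := hf.2.2.1 j h1 (by omega)
    obtain ⟨h5, h6⟩ := ih u h3 (by omega)
    obtain ⟨h7, h8⟩ := hf.2.2.2.2.1 u j h3 h1 (by omega)
    exact ⟨h5.trans h7, fun h => h6 (hG _ _ _ h5 h7 h).1⟩

lemma exists_arm_movable (hG : IsNUIG G) {f : Fin n → Fin (n + 1) × Fin (n + 1)} (hf : IsHookTab G f)
    (c : Fin n) (hc : f c = (0, 0)) (j : Fin n) (hj : InArm f j) 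
    (hmax : ∀ u, InArm f u → ((f u).2 : ℕ) ≤ (f j).2) : ∃ g, ArmToLeg G f g j := by
  obtain ⟨hj1, hj2⟩ := hj
  have hc1 : ((f c).1 : ℕ) = 0 := by simp [hc]
  have hc2 : ((f c).2 : ℕ) = 0 := by simp [hc]
  have hcj := corner_lt hG hf c hc1 (((f j).2 : ℕ) - 1) j hj1 (by omega)
  have hn : 1 < n + 1 := by have := j.2; omega
  have hex : ∃ p : ℕ, 1 ≤ p ∧ ∀ u, ((f u).2 : ℕ) = 0 → ((f u).1 : ℕ) = p → (j < u ∨ G.Adj j u) :=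
    ⟨n + 1, by omega, fun u _ h => by have := (f u).1.2; omega⟩
  set p := Nat.find hex with hp
  obtain ⟨hp1, hp2⟩ := Nat.find_spec hex
  rw [← hp] at hp1 hp2
  -- entries above row p
  have habove : ∀ u, ((f u).2 : ℕ) = 0 → ((f u).1 : ℕ) < p → u < j ∧ ¬ G.Adj j u := by
    intro u h1 h2
    by_cases h0 : ((f u).1 : ℕ) = 0
    · have : u = c := hf.inj' (by omega) (by omega)
      rw [this]; exact ⟨hcj.1, fun h => hcj.2 h.symm⟩
    · have := Nat.find_min hex h2
      push Not at this
      obtain ⟨w, h3, h4, h5⟩ := this (by omega)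
      have hw : u = w := hf.inj' (by omega) (by omega)
      subst hw
      refine ⟨?_, h5.2⟩
      rcases lt_or_eq_of_le h5.1 with h | h
      · exact h
      · subst h; omega
  have hfill : ∀ r < p, ∃ u, ((f u).2 : ℕ) = 0 ∧ ((f u).1 : ℕ) = r := by
    intro r hr
    by_cases h0 : r = 0
    · exact ⟨c, hc2, by omega⟩
    · have := Nat.find_min hex hr
      push Not at this
      obtain ⟨w, h3, h4, h5⟩ := this (by omega)
      exact ⟨w, h3, h4⟩
  have hpn : p < n + 1 := by
    obtain ⟨u, h1, h2⟩ := hfill (p-1) (by omega)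
    have := row_lt_n' hf u j h1 hj2
    omega
  set g : Fin n → Fin (n + 1) × Fin (n + 1) := fun u =>
    if u = j then (⟨p, hpn⟩, 0) else
      if h : ((f u).2 : ℕ) = 0 ∧ p ≤ ((f u).1 : ℕ) then
        (⟨((f u).1 : ℕ) + 1, by have := row_lt_n' hf u j h.1 hj2; omega⟩, 0) else f u with hg
  have gj1 : ((g j).1 : ℕ) = p := by simp [hg]
  have gj2 : ((g j).2 : ℕ) = 0 := by simp [hg]
  have glow1 : ∀ u, u ≠ j → ((f u).2 : ℕ) = 0 → p ≤ ((f u).1 : ℕ) → ((g u).1 : ℕ) = (f u).1 + 1 := by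
    intro u h1 h2 h3
    simp only [hg, if_neg h1, dif_pos (And.intro h2 h3)]
  have gup : ∀ u, u ≠ j → ¬ (((f u).2 : ℕ) = 0 ∧ p ≤ ((f u).1 : ℕ)) → g u = f u := by
    intro u h1 h2
    simp only [hg, if_neg h1, dif_neg h2]
  have g2 : ∀ u, u ≠ j → ((g u).2 : ℕ) = (f u).2 := by
    intro u h1
    by_cases h : ((f u).2 : ℕ) = 0 ∧ p ≤ ((f u).1 : ℕ)
    · simp only [hg, if_neg h1, dif_pos h]; simp [h.1]
    · rw [gup u h1 h]
  have gup1 : ∀ u, u ≠ j → ((f u).1 : ℕ) < p → ((g u).1 : ℕ) = (f u).1 := by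
    intro u h1 h2
    rw [gup u h1 (by omega)]
  have hook := hf.2.1
  have ghigh : ∀ u, u ≠ j → p ≤ ((f u).1 : ℕ) → ((g u).1 : ℕ) = (f u).1 + 1 := by
    intro u h1 h2
    exact glow1 u h1 (by have := hook u; omega) h2
  have colne : ∀ u, u ≠ j → ((f u).1 : ℕ) = 0 → ((f u).2 : ℕ) < (f j).2 := by
    intro u h1 h2
    rcases Nat.lt_trichotomy ((f u).2 : ℕ) (f j).2 with h | h | h
    · exact h
    · exact absurd (hf.inj' (by omega) h) h1
    · have := hmax u ⟨h2, by omega⟩; omega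
  clear_value g p
  have gcase : ∀ u, u ≠ j → (((f u).1 : ℕ) < p ∧ ((g u).1 : ℕ) = (f u).1) ∨ 
     (p ≤ ((f u).1 : ℕ) ∧ ((g u).1 : ℕ) = (f u).1 + 1) := by
    intro u h
    rcases Nat.lt_or_ge ((f u).1 : ℕ) p with h1 | h1
    · exact Or.inl ⟨h1, gup1 u h h1⟩
    · exact Or.inr ⟨h1, ghigh u h h1⟩
  refine ⟨g, ⟨hj1, hj2⟩, ⟨gj2, by omega⟩, ⟨?_, ?_, ?_, ?_, ?_, ?_⟩, ?_, ?_, ?_, ?_⟩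
  · intro u v huv
    have e1 : ((g u).1 : ℕ) = (g v).1 := by rw [huv]
    have e2 : ((g u).2 : ℕ) = (g v).2 := by rw [huv]
    by_cases hu : u = j
    · by_cases hv : v = j
      · rw [hu, hv]
      · have := gcase v hv; rw [hu] at e1; omega
    · by_cases hv : v = j
      · have := gcase u hu; rw [hv] at e1; omega
      · have := gcase v hv; have := gcase u hu
        have := g2 u hu
        have := g2 v hv
        exact hf.inj' (by omega) (by omega)
  · intro v
    by_cases hv : v = j
    · rw [hv]; exact Or.inr gj2
    · have := gcase v hv; have := g2 v hv; have := hook v; omega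
  · intro v h1 h2
    have hv : v ≠ j := by rintro rfl; omega
    have := gcase v hv; have := g2 v hv
    obtain ⟨u, h3, h4⟩ := hf.2.2.1 v (by omega) (by omega)
    have := colne v hv (by omega)
    have hu : u ≠ j := by rintro rfl; omega
    have := gcase u hu; have := g2 u hu
    exact ⟨u, by omega, by omega⟩
  · intro v h1 h2
    by_cases hv : v = j
    · obtain ⟨u, h3, h4⟩ := hfill (p-1) (by omega)
      have hu : u ≠ j := by rintro rfl; omega
      have := gcase u hu; have := g2 u hu
      rw [hv]
      exact ⟨u, by omega, by omega⟩
    · have := gcase v hv; have := g2 v hv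
      by_cases hpv : p = ((f v).1 : ℕ)
      · exact ⟨j, gj2, by omega⟩
      · obtain ⟨u, h3, h4⟩ := hf.2.2.2.1 v (by omega) (by omega)
        have hu : u ≠ j := by rintro rfl; omega
        have := gcase u hu; have := g2 u hu
        exact ⟨u, by omega, by omega⟩
  · intro u v h1 h2 h3
    have hu : u ≠ j := by rintro rfl; omega
    have hv : v ≠ j := by rintro rfl; omega
    have := gcase v hv; have := g2 v hv
    have := gcase u hu; have := g2 u hu
    exact hf.2.2.2.2.1 u v (by omega) (by omega) (by omega)
  · intro u v h1 h2 h3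
    by_cases hu : u = j
    · by_cases hv : v = j
      · rw [hu, hv] at h3; omega
      · have := gcase v hv; have := g2 v hv
        rw [hu] at h3 ⊢
        exact hp2 v (by omega) (by omega)
    · have := gcase u hu; have := g2 u hu
      by_cases hv : v = j
      · rw [hv] at h3 ⊢
        exact Or.inl (habove u (by omega) (by omega)).1
      · have := gcase v hv; have := g2 v hv
        have hnp : ((f u).1 : ℕ) < p → ((f v).1 : ℕ) < p := by
          intro h; omega
        exact hf.2.2.2.2.2 u v (by omega) (by omega) (by omega)
  · intro u hu
    have := gcase u hu; have := g2 u hu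
    unfold InArm InLeg
    omega
  · intro u u' hu hu' _ _
    have := g2 u hu; have := g2 u' hu'
    omega
  · intro u u' hu hu' _ _
    have := gcase u hu; have := gcase u' hu'
    omega
  · have hnadj : ∀ u, u ≠ j → ((f u).1 : ℕ) < p → ¬ G.Adj j u := by
      intro u hu h1 hadj
      by_cases h0 : ((f u).2 : ℕ) = 0
      · exact (habove u h0 h1).2 hadj
      · have h2 := hook u
        -- both in the first row
        have hlt := colne u hu (by omega)
        exact (corner_lt hG hf u (by omega) (((f j).2 : ℕ) - (f u).2 - 1) j hj1 (by omega)).2 hadj.symm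
    ext ⟨a, b⟩
    simp only [InvSet, Finset.mem_filter, Finset.mem_univ, true_and]
    refine and_congr_right fun hab => and_congr_right fun hadj => ?_
    by_cases ha : a = j
    · have hb : b ≠ j := by rintro rfl; exact absurd hab (by simp [ha])
      have := gcase b hb
      have hnb := hnadj b hb
      rw [ha] at hadj ⊢
      have : ¬ ((f b).1 : ℕ) < p := fun h => hnb h hadj
      omega
    · by_cases hb : b = j
      · have := gcase a ha
        have hnb := hnadj a ha
        rw [hb] at hadj ⊢
        have : ¬ ((f a).1 : ℕ) < p := fun h => hnb h hadj.symm
        omega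
      · have := gcase b hb
        have := gcase a ha
        omega


lemma leg_not_movable {f : Fin n → Fin (n + 1) × Fin (n + 1)} (hf : IsHookTab G f)
    (hcol : ∀ v, ((f v).2 : ℕ) = 0) (j : Fin n) (u : Fin n) (hadj : G.Adj u j)
    (hu : ((f u).1 : ℕ) < (f j).1) (g : Fin n → Fin (n + 1) × Fin (n + 1)) : ¬ LegToArm G f g j := by
  rintro ⟨h1, h2, h3, h4, -, -, h7⟩
  have huj : u ≠ j := hadj.ne
  rcases lt_or_gt_of_ne huj with hlt | hlt
  · have hn : (u, j) ∉ InvSet G g := by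
      rw [h7]; simp [InvSet]; intros; omega
    have hgu : ((g u).1 : ℕ) = 0 := by
      by_contra h0
      apply hn
      simp only [InvSet, Finset.mem_filter, Finset.mem_univ, true_and]
      exact ⟨hlt, hadj, by have := h2.1; omega⟩
    -- the element to the left of j in g
    obtain ⟨w, hw1, hw2⟩ := h3.2.2.1 j h2.1 (by have := h2.2; omega)
    have hwj : w ≠ j := by rintro rfl; omega
    have hu4 := h4 u huj
    have hw4 := h4 w hwj
    unfold InArm InLeg at hu4 hw4
    have e1 := hcol u
    have e2 := hcol w
    have : u = w := h3.inj' (by omega) (by omega)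
    subst this
    exact (h3.2.2.2.2.1 u j hw1 h2.1 hw2.symm).2 hadj
  · have : (j, u) ∈ InvSet G f := by
      simp only [InvSet, Finset.mem_filter, Finset.mem_univ, true_and]
      exact ⟨hlt, hadj.symm, hu⟩
    rw [← h7] at this
    simp only [InvSet, Finset.mem_filter, Finset.mem_univ, true_and] at this
    have := h2.1
    omega

lemma leg_movable (hG : IsNUIG G) {f : Fin n → Fin (n + 1) × Fin (n + 1)} (hf : IsHookTab G f)
    (hcol : ∀ v, ((f v).2 : ℕ) = 0) (j : Fin n) (hj : ((f j).1 : ℕ) ≠ 0)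
    (hnb : ∀ u, G.Adj u j → ¬ ((f u).1 : ℕ) < (f j).1) :
    ∃ g, LegToArm G f g j := by
  have hn : 1 < n + 1 := by have := j.2; omega
  have habove : ∀ d u, ((f u).1 : ℕ) + d + 1 = (f j).1 → u < j := by
    intro d
    induction d with
    | zero =>
      intro u hu
      rcases hf.2.2.2.2.2 u j (hcol u) (hcol j) (by omega) with h | h
      · exact h
      · exact absurd (by omega) (hnb u h)
    | succ d ih =>
      intro u hu
      obtain ⟨w, -, hw⟩ := row_filled hf j (hcol j) (d+1) (((f u).1 : ℕ) + 1) (by omega)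
      have hwj := ih w (by omega)
      have hnu : ¬ G.Adj u j := fun h => hnb u h (by omega)
      have hnw : ¬ G.Adj w j := fun h => hnb w h (by omega)
      by_contra hge
      have hne : u ≠ j := by rintro rfl; omega
      have hju : j < u := lt_of_le_of_ne (not_lt.1 hge) hne.symm
      rcases hf.2.2.2.2.2 u w (hcol u) (hcol w) (by omega) with h | h
      · exact absurd (h.trans hwj) hge
      · exact hnw (hG w j u hwj hju h.symm).1
  have habove' : ∀ u, ((f u).1 : ℕ) < (f j).1 → u < j ∧ ¬ G.Adj u j := fun u hu =>
    ⟨habove (((f j).1 : ℕ) - (f u).1 - 1) u (by omega), fun h => hnb u h hu⟩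
  set g : Fin n → Fin (n + 1) × Fin (n + 1) := fun u =>
    if u = j then (0, ⟨1, hn⟩) else
      (⟨if ((f u).1 : ℕ) < (f j).1 then ((f u).1 : ℕ) else ((f u).1 : ℕ) - 1,
        by have := (f u).1.2; split <;> omega⟩, 0) with hg
  have gj1 : ((g j).1 : ℕ) = 0 := by simp [hg]
  have gj2 : ((g j).2 : ℕ) = 1 := by simp [hg]
  have g2 : ∀ u, u ≠ j → ((g u).2 : ℕ) = 0 := by
    intro u h1; simp [hg, h1]
  have gcase : ∀ u, u ≠ j → (((f u).1 : ℕ) < (f j).1 ∧ ((g u).1 : ℕ) = (f u).1) ∨ 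
     (((f j).1 : ℕ) < ((f u).1 : ℕ) ∧ ((g u).1 : ℕ) + 1 = (f u).1) := by
    intro u h
    have hne : ((f u).1 : ℕ) ≠ (f j).1 := fun h' => h (hf.inj' h' (by rw [hcol, hcol]))
    have : ((g u).1 : ℕ) = if ((f u).1 : ℕ) < (f j).1 then ((f u).1 : ℕ) else ((f u).1 : ℕ) - 1 := by
      simp only [hg, if_neg h]
    rw [this]
    split <;> omega
  clear_value g
  obtain ⟨c, -, hc⟩ := row_filled hf j (hcol j) ((f j).1 : ℕ) 0 (by omega)
  have hcne : c ≠ j := by rintro rfl; omega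
  have hgc := gcase c hcne
  have hgc2 := g2 c hcne
  refine ⟨g, ⟨hcol j, hj⟩, ⟨gj1, by omega⟩, ⟨?_, ?_, ?_, ?_, ?_, ?_⟩, ?_, ?_, ?_, ?_⟩
  · intro u v huv
    have e1 : ((g u).1 : ℕ) = (g v).1 := by rw [huv]
    have e2 : ((g u).2 : ℕ) = (g v).2 := by rw [huv]
    by_cases hu : u = j
    · by_cases hv : v = j
      · rw [hu, hv]
      · have := g2 v hv; rw [hu] at e2; omega
    · by_cases hv : v = j
      · have := g2 u hu; rw [hv] at e2; omega
      · have := gcase v hv; have := gcase u hu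
        exact hf.inj' (by omega) (by rw [hcol, hcol])
  · intro v
    by_cases hv : v = j
    · rw [hv]; exact Or.inl gj1
    · exact Or.inr (g2 v hv)
  · intro v h1 h2
    have hv : v = j := by by_contra h; have := g2 v h; omega
    rw [hv]
    exact ⟨c, by omega, by omega⟩
  · intro v h1 h2
    have hv : v ≠ j := by rintro rfl; omega
    have := gcase v hv
    obtain ⟨u, h3, h4⟩ := hf.2.2.2.1 v (hcol v) (by omega)
    by_cases hu : u = j
    · rw [hu] at h4
      obtain ⟨w, h5, h6⟩ := hf.2.2.2.1 j (hcol j) (by omega)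
      have hw : w ≠ j := by rintro rfl; omega
      have := gcase w hw
      exact ⟨w, g2 w hw, by omega⟩
    · have := gcase u hu
      exact ⟨u, g2 u hu, by omega⟩
  · intro u v h1 h2 h3
    have hv : v = j := by by_contra h; have := g2 v h; omega
    have hu : u ≠ j := by rintro rfl; rw [hv] at h3; omega
    have := gcase u hu
    rw [hv]
    exact habove' u (by omega)
  · intro u v h1 h2 h3
    have hu : u ≠ j := by rintro rfl; omega
    have hv : v ≠ j := by rintro rfl; omega
    have := gcase v hv
    have := gcase u hu
    by_cases hcons : ((f v).1 : ℕ) = (f u).1 + 1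
    · exact hf.2.2.2.2.2 u v (hcol u) (hcol v) hcons
    · have hu' := habove' u (by omega)
      have := hf.2.2.2.2.2 j v (hcol j) (hcol v) (by omega)
      by_contra hcon
      push Not at hcon
      have hvu : v < u := lt_of_le_of_ne hcon.1 (by rintro rfl; omega)
      rcases this with h | h
      · exact absurd (hvu.trans hu'.1) (not_lt.2 h.le)
      · exact hu'.2 (hG v u j hvu hu'.1 h.symm).2
  · intro u hu
    have := gcase u hu; have := g2 u hu
    have := hcol u
    have : ((f u).1 : ℕ) = 0 ↔ ((g u).1 : ℕ) = 0 := by omega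
    unfold InArm InLeg
    omega
  · intro u u' hu hu' h _
    exact absurd (hcol u) h.2
  · intro u u' hu hu' _ _
    have := gcase u hu; have := gcase u' hu'
    omega
  · ext ⟨a, b⟩
    simp only [InvSet, Finset.mem_filter, Finset.mem_univ, true_and]
    refine and_congr_right fun hab => and_congr_right fun hadj => ?_
    by_cases ha : a = j
    · have hb : b ≠ j := by rintro rfl; exact absurd hab (by simp [ha])
      have := gcase b hb
      rw [ha] at hadj ⊢
      have := hnb b hadj.symm
      omega
    · by_cases hb : b = j
      · have := gcase a ha
        rw [hb] at hadj ⊢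
        have := hnb a hadj
        omega
      · have := gcase b hb
        have := gcase a ha
        omega

lemma fixed_iff (hG : IsNUIG G) (T : HT n G) (j : Fin n) (hj : T.1 j = (0, 0)) :
    phi T = T ↔ (∀ v, ((T.1 v).2 : ℕ) = 0) ∧
      ∀ v, v ≠ j → ∃ u, G.Adj u v ∧ ((T.1 u).1 : ℕ) < (T.1 v).1 := by
  rw [phi_fixed_iff]
  obtain ⟨f, hf⟩ := T
  simp only [] at hj ⊢
  constructor
  · intro h
    have hcol : ∀ v, ((f v).2 : ℕ) = 0 := by
      by_contra hc
      push Not at hc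
      obtain ⟨v, hv⟩ := hc
      have hne : (Finset.univ.filter (fun v => InArm f v)).Nonempty :=
        ⟨v, by simp only [Finset.mem_filter, Finset.mem_univ, true_and]; 
               exact ⟨(hf.2.1 v).resolve_right hv, hv⟩⟩
      obtain ⟨w, hw, hmax⟩ := Finset.exists_max_image _ (fun v => ((f v).2 : ℕ)) hne
      simp only [Finset.mem_filter, Finset.mem_univ, true_and] at hw hmax
      exact h w (Or.inl (exists_arm_movable hG hf j hj w hw hmax))
    refine ⟨hcol, fun v hv => ?_⟩
    by_contra hcon
    push Not at hcon
    have hv0 : ((f v).1 : ℕ) ≠ 0 := fun h0 => hv (hf.inj' (by simp [hj, h0]) (by rw [hcol, hcol]))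
    exact h v (Or.inr (leg_movable hG hf hcol v hv0 (fun u hu => not_lt.2 (hcon u hu))))
  · rintro ⟨hcol, hnb⟩ v hv
    rcases hv with ⟨g, hg⟩ | ⟨g, hg⟩
    · exact hg.1.2 (hcol v)
    · have hvj : v ≠ j := by rintro rfl; exact hg.1.2 (by simp [hj])
      obtain ⟨u, h1, h2⟩ := hnb v hvj
      exact leg_not_movable hf hcol v u h1 h2 g hg


lemma Conn_iff (A : ℕ → ℕ → Prop) (l : List ℕ) : ∀ S : Set ℕ,
    Conn A S l ↔ ∀ (i : ℕ) (v : ℕ), l[i]? = some v → ∃ u, A u v ∧ (u ∈ S ∨ ∃ k < i, l[k]? = some u) := by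
  induction l with
  | nil => intro S; simp [Conn]
  | cons a l ih =>
    intro S
    rw [Conn, ih]
    constructor
    · rintro ⟨⟨u, h1, h2⟩, h3⟩ i v hi
      cases i with
      | zero =>
        simp at hi; subst hi
        exact ⟨u, h2, Or.inl h1⟩
      | succ i =>
        obtain ⟨w, hw, hw'⟩ := h3 i v (by simpa using hi)
        refine ⟨w, hw, ?_⟩
        rcases hw' with (rfl | h) | ⟨k, hk, hk'⟩
        · exact Or.inr ⟨0, by omega, by simp⟩
        · exact Or.inl h
        · exact Or.inr ⟨k+1, by omega, by simpa using hk'⟩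
    · intro h
      refine ⟨?_, ?_⟩
      · obtain ⟨u, h1, h2⟩ := h 0 a (by simp)
        refine ⟨u, ?_, h1⟩
        rcases h2 with h2 | ⟨k, hk, -⟩
        · exact h2
        · omega
      · intro i v hi
        obtain ⟨u, h1, h2⟩ := h (i+1) v (by simpa using hi)
        refine ⟨u, h1, ?_⟩
        rcases h2 with h2 | ⟨k, hk, hk'⟩
        · exact Or.inl (Or.inr h2)
        · cases k with
          | zero => simp at hk'; exact Or.inl (Or.inl hk'.symm)
          | succ k => exact Or.inr ⟨k, by omega, by simpa using hk'⟩

lemma linv_eq (A : ℕ → ℕ → Prop) (l : List ℕ) (hl : l.Nodup) : 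
    linv A l = ((l.toFinset ×ˢ l.toFinset).filter (fun p => p.1 < p.2 ∧ A p.1 p.2 ∧
      l.idxOf p.2 < l.idxOf p.1)).card := by
  induction l with
  | nil => simp [linv]
  | cons a l ih =>
    rw [List.nodup_cons] at hl
    rw [linv, ih hl.2]
    have e : (((a :: l).toFinset ×ˢ (a :: l).toFinset).filter (fun p => p.1 < p.2 ∧ A p.1 p.2 ∧
      (a :: l).idxOf p.2 < (a :: l).idxOf p.1)) = 
      ((l.toFinset.filter (fun b => b < a ∧ A b a)).image (fun b => (b, a))) ∪
      ((l.toFinset ×ˢ l.toFinset).filter (fun p => p.1 < p.2 ∧ A p.1 p.2 ∧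
      l.idxOf p.2 < l.idxOf p.1)) := by
      ext ⟨u, v⟩
      simp only [Finset.mem_coe, Finset.mem_filter, Finset.mem_product, List.mem_toFinset, Finset.mem_union,
        Finset.mem_image, Prod.mk.injEq, List.mem_cons, List.idxOf_cons]
      by_cases hu : a = u
      · subst hu
        by_cases hv : a = v
        · subst hv; simp
        · simp [hv, hl.1]
      · by_cases hv : a = v
        · subst hv; simp [hu, hl.1]; grind
        · simp [hu, hv]; grind
    rw [e, Finset.card_union_of_disjoint, Finset.card_image_of_injective]
    · congr 1
      rw [List.countP_eq_length_filter, ← List.toFinset_card_of_nodup (hl.2.filter _)]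
      congr 1
      ext x; simp
    · intro x y h; simpa using h
    · rw [Finset.disjoint_left]
      rintro ⟨u, v⟩ h1 h2
      simp at h1 h2
      grind

/-- the graph as a relation on `ℕ` -/
def AA (G : SimpleGraph (Fin n)) (u v : ℕ) : Prop := ∃ (hu : u < n) (hv : v < n), G.Adj ⟨u, hu⟩ ⟨v, hv⟩

lemma AA_coe (u v : Fin n) : AA G u v ↔ G.Adj u v := by
  simp [AA]

/-- the list `l` is the column of `f` read from top to bottom -/
def ColRel (f : Fin n → Fin (n + 1) × Fin (n + 1)) (l : List ℕ) : Prop :=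
  l.length = n ∧ (∀ v, ((f v).2 : ℕ) = 0) ∧ ∀ v : Fin n, l[((f v).1 : ℕ)]? = some (v : ℕ)

lemma ColRel.lt {f : Fin n → Fin (n + 1) × Fin (n + 1)} {l : List ℕ} (h : ColRel f l) (v : Fin n) :
    ((f v).1 : ℕ) < n := by
  have := h.2.2 v
  rw [List.getElem?_eq_some_iff] at this
  obtain ⟨h1, -⟩ := this
  have := h.1
  omega

lemma ColRel.surj {f : Fin n → Fin (n + 1) × Fin (n + 1)} {l : List ℕ} (h : ColRel f l) (i : ℕ) (hi : i < n) :
    ∃ v, ((f v).1 : ℕ) = i := by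
  have hinj : Function.Injective (fun v : Fin n => (⟨(f v).1, h.lt v⟩ : Fin n)) := by
    intro u v huv
    simp only [Fin.mk.injEq] at huv
    have h1 := h.2.2 u
    have h2 := h.2.2 v
    rw [huv, h2] at h1
    simp at h1
    exact (Fin.ext h1).symm
  obtain ⟨v, hv⟩ := (Finite.injective_iff_surjective.1 hinj) ⟨i, hi⟩
  exact ⟨v, by simpa using hv⟩

lemma ColRel.row {f : Fin n → Fin (n + 1) × Fin (n + 1)} {l : List ℕ} (h : ColRel f l) (i : ℕ) (v : Fin n) 
    (hi : l[i]? = some (v : ℕ)) : ((f v).1 : ℕ) = i := by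
  have h1 : i < n := by
    rw [List.getElem?_eq_some_iff] at hi
    obtain ⟨h2, -⟩ := hi
    have := h.1
    omega
  obtain ⟨w, hw⟩ := h.surj i h1
  have := h.2.2 w
  rw [hw, hi] at this
  simp at this
  have : v = w := Fin.ext this
  rw [this, hw]

lemma ColRel.val {f : Fin n → Fin (n + 1) × Fin (n + 1)} {l : List ℕ} (h : ColRel f l) (i : ℕ) (x : ℕ) 
    (hi : l[i]? = some x) : ∃ v : Fin n, (v : ℕ) = x ∧ ((f v).1 : ℕ) = i := by
  have h1 : i < n := by
    rw [List.getElem?_eq_some_iff] at hi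
    obtain ⟨h2, -⟩ := hi
    have := h.1
    omega
  obtain ⟨w, hw⟩ := h.surj i h1
  have := h.2.2 w
  rw [hw, hi] at this
  simp at this
  exact ⟨w, this.symm, hw⟩

lemma ColRel.nodup {f : Fin n → Fin (n + 1) × Fin (n + 1)} {l : List ℕ} (h : ColRel f l) : l.Nodup := by
  rw [List.nodup_iff_getElem?_ne_getElem?]
  intro i k hik hk he
  obtain ⟨v, hv, hv'⟩ := h.val k _ (List.getElem?_eq_getElem hk)
  obtain ⟨w, hw, hw'⟩ := h.val i _ (he.trans (List.getElem?_eq_getElem hk))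
  have : v = w := Fin.ext (by omega)
  subst this
  omega

lemma ColRel.mem {f : Fin n → Fin (n + 1) × Fin (n + 1)} {l : List ℕ} (h : ColRel f l) (x : ℕ) : 
    x ∈ l ↔ x < n := by
  rw [List.mem_iff_getElem?]
  constructor
  · rintro ⟨i, hi⟩
    obtain ⟨v, hv, -⟩ := h.val i x hi
    rw [← hv]; exact v.2
  · intro hx
    exact ⟨_, h.2.2 ⟨x, hx⟩⟩

lemma ColRel.perm {f : Fin n → Fin (n + 1) × Fin (n + 1)} {l : List ℕ} (h : ColRel f l) :
    l.Perm (List.range n) := by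
  rw [List.perm_ext_iff_of_nodup h.nodup List.nodup_range]
  intro a
  rw [h.mem]; simp

lemma ColRel.chain_iff {f : Fin n → Fin (n + 1) × Fin (n + 1)} {l : List ℕ} (h : ColRel f l) :
    l.IsChain (fun u v => u < v ∨ AA G u v) ↔ IsHookTab G f := by
  rw [List.isChain_iff_getElem]
  constructor
  · intro hc
    refine ⟨?_, fun v => Or.inr (h.2.1 v), ?_, ?_, ?_, ?_⟩
    · intro u v huv
      have h1 := h.2.2 u
      have h2 := h.2.2 v
      rw [huv, h2] at h1
      simp at h1
      exact (Fin.ext h1).symm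
    · intro v _ h2
      have := h.2.1 v; omega
    · intro v _ h2
      obtain ⟨u, hu⟩ := h.surj (((f v).1 : ℕ) - 1) (by have := h.lt v; omega)
      exact ⟨u, h.2.1 u, by omega⟩
    · intro u v _ _ h3
      have := h.2.1 v; omega
    · intro u v _ _ h3
      have hl := h.1
      have hv := h.lt v
      have := hc (f u).1 (by omega)
      have e1 := h.2.2 u
      have e2 := h.2.2 v
      rw [List.getElem?_eq_getElem (by omega)] at e1 e2
      simp only [Option.some.injEq] at e1 e2
      simp only [← h3, e1, e2, AA_coe] at this
      exact this
  · intro hf i hi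
    obtain ⟨v, hv, hv'⟩ := h.val (i+1) _ (List.getElem?_eq_getElem hi)
    obtain ⟨u, hu, hu'⟩ := h.val i _ (List.getElem?_eq_getElem (by omega))
    rw [← hu, ← hv, AA_coe]
    exact hf.2.2.2.2.2 u v (h.2.1 u) (h.2.1 v) (by omega)

lemma ColRel.conn_iff {f : Fin n → Fin (n + 1) × Fin (n + 1)} {l : List ℕ} (h : ColRel f l) (j : Fin n) :
    (∃ t, l = (j : ℕ) :: t ∧ Conn (AA G) {(j : ℕ)} t) ↔
    (f j = (0, 0) ∧ ∀ v, v ≠ j → ∃ u, G.Adj u v ∧ ((f u).1 : ℕ) < (f v).1) := by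
  constructor
  · rintro ⟨t, rfl, ht⟩
    have hj0 : ((f j).1 : ℕ) = 0 := h.row 0 j (by simp)
    refine ⟨Prod.ext (Fin.ext hj0) (Fin.ext (h.2.1 j)), ?_⟩
    intro v hv
    rw [Conn_iff] at ht
    have hv2 := h.2.2 v
    cases hr : ((f v).1 : ℕ) with
    | zero =>
      rw [hr] at hv2; simp at hv2
      exact absurd (Fin.ext hv2.symm) hv
    | succ r =>
      rw [hr] at hv2
      obtain ⟨u, ⟨h1, h1', hadj⟩, h2⟩ := ht r v (by simpa using hv2)
      refine ⟨⟨u, h1⟩, hadj, ?_⟩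
      rcases h2 with h2 | ⟨k, hk, hk'⟩
      · have : (⟨u, h1⟩ : Fin n) = j := Fin.ext h2
        rw [this]; omega
      · have := h.row (k+1) ⟨u, h1⟩ (by simpa using hk')
        omega
  · rintro ⟨h0, h1⟩
    have hj := h.2.2 j
    rw [h0] at hj
    cases l with
    | nil => simp at hj
    | cons a t =>
      simp at hj
      subst hj
      refine ⟨t, rfl, ?_⟩
      rw [Conn_iff]
      intro i x hx
      obtain ⟨v, rfl, hv⟩ := h.val (i+1) x (by simpa using hx)
      obtain ⟨u, hu, hu'⟩ := h1 v (by rintro rfl; simp [h0] at hv)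
      refine ⟨u, (AA_coe u v).2 hu, ?_⟩
      have e := h.2.2 u
      cases hr : ((f u).1 : ℕ) with
      | zero => rw [hr] at e; simp at e; exact Or.inl e.symm
      | succ k =>
        rw [hr] at e
        exact Or.inr ⟨k, by omega, by simpa using e⟩

lemma ColRel.idx {f : Fin n → Fin (n + 1) × Fin (n + 1)} {l : List ℕ} (h : ColRel f l) (v : Fin n) :
    l.idxOf (v : ℕ) = (f v).1 := by
  have hm : (v : ℕ) ∈ l := (h.mem _).2 v.2
  symm
  apply h.row
  rw [List.getElem?_eq_getElem (List.idxOf_lt_length_of_mem hm), List.getElem_idxOf]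

lemma ColRel.inv {f : Fin n → Fin (n + 1) × Fin (n + 1)} {l : List ℕ} (h : ColRel f l) :
    linv (AA G) l = (InvSet G f).card := by
  rw [linv_eq _ _ h.nodup]
  symm
  refine Finset.card_nbij (fun p => ((p.1 : ℕ), (p.2 : ℕ))) ?_ ?_ ?_
  · rintro ⟨u, v⟩ hp
    simp only [InvSet, Finset.mem_coe, Finset.mem_filter, Finset.mem_univ, true_and] at hp
    simp only [Finset.mem_coe, Finset.mem_filter, Finset.mem_product, List.mem_toFinset, h.mem, h.idx, AA_coe]
    exact ⟨⟨u.2, v.2⟩, hp⟩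
  · rintro ⟨u, v⟩ _ ⟨u', v'⟩ _ he
    simp only [Prod.mk.injEq] at he
    exact Prod.ext (Fin.ext he.1) (Fin.ext he.2)
  · rintro ⟨x, y⟩ hp
    simp only [Finset.mem_coe, Finset.mem_filter, Finset.mem_product, List.mem_toFinset, h.mem] at hp
    obtain ⟨⟨hx, hy⟩, h1, h2, h3⟩ := hp
    refine ⟨(⟨x, hx⟩, ⟨y, hy⟩), ?_, rfl⟩
    simp only [InvSet, Finset.mem_coe, Finset.mem_filter, Finset.mem_univ, true_and]
    refine ⟨h1, (AA_coe _ _).1 h2, ?_⟩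
    rw [← h.idx, ← h.idx]
    exact h3

/-- reading word of a column -/
noncomputable def LL (f : Fin n → Fin (n + 1) × Fin (n + 1)) : List ℕ :=
  (List.range n).map (fun i => if h : ∃ v, ((f v).1 : ℕ) = i then ((Classical.choose h : Fin n) : ℕ) else 0)

lemma ColRel_LL {f : Fin n → Fin (n + 1) × Fin (n + 1)} (hf : IsHookTab G f)
    (hcol : ∀ v, ((f v).2 : ℕ) = 0) : ColRel f (LL f) := by
  refine ⟨by simp [LL], hcol, fun v => ?_⟩
  have hv := row_lt_n hf v (hcol v)
  have hex : ∃ u, ((f u).1 : ℕ) = (f v).1 := ⟨v, rfl⟩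
  have : Classical.choose hex = v := hf.inj' (Classical.choose_spec hex) (by rw [hcol, hcol])
  simp only [LL, List.getElem?_map, List.getElem?_range hv, Option.map_some]
  rw [dif_pos hex, this]

lemma exists_ColRel (l : List ℕ) (hl : l.Perm (List.range n)) : 
    ∃ f : Fin n → Fin (n + 1) × Fin (n + 1), ColRel f l := by
  have hlen : l.length = n := by rw [hl.length_eq]; simp
  have hm : ∀ v : Fin n, (v : ℕ) ∈ l := fun v => hl.mem_iff.2 (by simp)
  have hlt : ∀ v : Fin n, l.idxOf (v : ℕ) < l.length := fun v => List.idxOf_lt_length_of_mem (hm v)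
  refine ⟨fun v => (⟨l.idxOf (v : ℕ), by have := hlt v; omega⟩, 0), hlen, fun _ => rfl, fun v => ?_⟩
  simp only []
  rw [List.getElem?_eq_getElem (hlt v), List.getElem_idxOf]

lemma ColRel.unique_list {f : Fin n → Fin (n + 1) × Fin (n + 1)} {l l' : List ℕ} (h : ColRel f l) (h' : ColRel f l') :
    l = l' := by
  apply List.ext_getElem?
  intro i
  by_cases hi : i < n
  · obtain ⟨v, rfl⟩ := h.surj i hi
    rw [h.2.2, h'.2.2]
  · have := h.1
    have := h'.1
    rw [List.getElem?_eq_none (by omega), List.getElem?_eq_none (by omega)]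

lemma ColRel.unique_fun {f f' : Fin n → Fin (n + 1) × Fin (n + 1)} {l : List ℕ} (h : ColRel f l) (h' : ColRel f' l) :
    f = f' := by
  funext v
  refine Prod.ext (Fin.ext ?_) (Fin.ext ?_)
  · rw [← h.idx, ← h'.idx]
  · rw [h.2.1, h'.2.1]

lemma sum_transfer (hG : IsNUIG G) (j : Fin n) :
    ∑ T ∈ Finset.univ.filter
        (fun T : HT n G => phi T = T ∧ T.1 j = (0, 0)),
        (Polynomial.X : Polynomial ℤ) ^ tabInv G T =
    ∑ l ∈ WW (AA G) n j, (Polynomial.X : Polynomial ℤ) ^ linv (AA G) l := by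
  have key : ∀ T ∈ Finset.univ.filter (fun T : HT n G => phi T = T ∧ T.1 j = (0, 0)),
      ColRel T.1 (LL T.1) ∧ ∀ v, v ≠ j → ∃ u, G.Adj u v ∧ ((T.1 u).1 : ℕ) < (T.1 v).1 := by
    intro T hT
    simp only [Finset.mem_coe, Finset.mem_filter, Finset.mem_univ, true_and] at hT
    have := (fixed_iff hG T j hT.2).1 hT.1
    exact ⟨ColRel_LL T.2 this.1, this.2⟩
  refine Finset.sum_nbij (fun T => LL T.1) ?_ ?_ ?_ ?_
  · intro T hT
    obtain ⟨h1, h2⟩ := key T hT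
    simp only [Finset.mem_coe, Finset.mem_filter, Finset.mem_univ, true_and] at hT
    rw [mem_WW]
    exact ⟨h1.perm, h1.chain_iff.2 T.2, (h1.conn_iff j).2 ⟨hT.2, h2⟩⟩
  · intro T hT T' hT' he
    have h1 := (key T hT).1
    have h2 := (key T' hT').1
    simp only [] at he
    rw [he] at h1
    exact Subtype.ext (h1.unique_fun h2)
  · intro l hl
    rw [Finset.mem_coe, mem_WW] at hl
    obtain ⟨h1, h2, h3⟩ := hl
    obtain ⟨f, hf⟩ := exists_ColRel l h1
    have hook : IsHookTab G f := hf.chain_iff.1 h2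
    have hc := (hf.conn_iff j).1 h3
    refine ⟨⟨f, hook⟩, ?_, (ColRel_LL hook hf.2.1).unique_list hf⟩
    simp only [Finset.mem_coe, Finset.mem_filter, Finset.mem_univ, true_and]
    exact ⟨(fixed_iff hG ⟨f, hook⟩ j hc.1).2 ⟨hf.2.1, hc.2⟩, hc.1⟩
  · intro T hT
    rw [(key T hT).1.inv, tabInv]

lemma bb_eq (k : Fin n) : bb (AA G) k = smallerNbrs G k := by
  rw [bb, smallerNbrs]
  symm
  refine Finset.card_nbij (fun i => (i : ℕ)) ?_ ?_ ?_
  · intro i hi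
    simp only [Finset.mem_coe, Finset.mem_filter, Finset.mem_univ, true_and, Finset.mem_range] at hi ⊢
    exact ⟨hi.1, (AA_coe _ _).2 hi.2⟩
  · intro a _ b _ h
    exact Fin.ext h
  · intro x hx
    simp only [Finset.mem_coe, Finset.mem_filter, Finset.mem_range] at hx
    refine ⟨⟨x, hx.1.trans k.2⟩, ?_, rfl⟩
    simp only [Finset.mem_coe, Finset.mem_filter, Finset.mem_univ, true_and]
    exact ⟨hx.1, (AA_coe _ _).1 hx.2⟩

end TabPart

/-- for every vertex `j` (the `(j+1)`-st vertex in the paper's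
`1,…,n` labelling), the sum of `q^(inv T)` over fixed points `T` of `φ_G` with
top entry `T_1 = j` equals `q^(j-1) [b_2]_q ⋯ [b_n]_q`. -/
theorem stmt16 (n : ℕ) (G : SimpleGraph (Fin n)) (hG : IsNUIG G) (j : Fin n) :
    ∑ T ∈ Finset.univ.filter
        (fun T : HT n G => phi T = T ∧ T.1 j = (0, 0)),
        (Polynomial.X : Polynomial ℤ) ^ tabInv G T
      = Polynomial.X ^ (j : ℕ) *
        ∏ k ∈ Finset.univ.filter (fun k : Fin n => 1 ≤ (k : ℕ)),
          qInt (smallerNbrs G k) := by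
  rw [sum_transfer hG j, list_main (AA G) ?_ ?_ ?_ n j j.2]
  · congr 1
    symm
    refine Finset.prod_nbij (fun k => (k : ℕ)) ?_ ?_ ?_ ?_
    · intro k hk
      simp only [Finset.mem_filter, Finset.mem_univ, true_and, Finset.mem_Ico] at hk ⊢
      exact ⟨hk, k.2⟩
    · intro a _ b _ h
      exact Fin.ext h
    · intro x hx
      simp only [Finset.coe_Ico, Set.mem_Ico] at hx
      refine ⟨⟨x, hx.2⟩, ?_, rfl⟩
      simpa using hx.1
    · intro k _
      rw [bb_eq]
  · rintro u v ⟨hu, hv, h⟩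
    exact ⟨hv, hu, h.symm⟩
  · rintro u ⟨hu, hv, h⟩
    exact h.ne rfl
  · rintro a b c hab hbc ⟨ha, hc, h⟩
    have := hG ⟨a, ha⟩ ⟨b, hbc.trans hc⟩ ⟨c, hc⟩ hab hbc h
    exact ⟨⟨_, _, this.1⟩, ⟨_, _, this.2⟩⟩
end

section
/- Let G be a graph with a perfect elimination order v_1, v_2, …, v_n of its vertices, and for 2 ≤ k ≤ n let b_k = #{v_j : v_j is adjacent to v_k and j < k}. Then the coefficient c_n of e_n in the chromatic symmetric function X_G(x) is the product c_n = n · b_2 · b_3 ⋯ b_n. -/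
open Finset MvPolynomial
open scoped Classical

noncomputable section

/-- `κ` is a proper colouring of `G`. -/
def IsProper {n N : ℕ} (G : SimpleGraph (Fin n)) (κ : Fin n → Fin N) : Prop :=
  ∀ i j, G.Adj i j → κ i ≠ κ j

/-- The chromatic symmetric function of `G`, truncated to `N` variables. -/
def chromSym (n N : ℕ) (G : SimpleGraph (Fin n)) : MvPolynomial (Fin N) ℤ :=
  ∑ κ : Fin n → Fin N, if IsProper G κ then ∏ i, X (κ i) else 0

/-- The number of ascents of a colouring. -/
def ascNum {n N : ℕ} (G : SimpleGraph (Fin n)) (κ : Fin n → Fin N) : ℕ :=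
  ((Finset.univ : Finset (Fin n × Fin n)).filter fun p =>
    G.Adj p.1 p.2 ∧ p.1 < p.2 ∧ κ p.1 < κ p.2).card

/-- The chromatic quasisymmetric function of `G`, with coefficients in `ℤ[q]`,
truncated to `N` variables. -/
def chromQSym (n N : ℕ) (G : SimpleGraph (Fin n)) :
    MvPolynomial (Fin N) (Polynomial ℤ) :=
  ∑ κ : Fin n → Fin N, if IsProper G κ then
    C (Polynomial.X ^ ascNum G κ) * ∏ i, X (κ i) else 0

/-- `e_λ`, the product of elementary symmetric polynomials over the parts of `λ`. -/
def eProd (N : ℕ) (R : Type) [CommSemiring R] {n : ℕ} (p : Nat.Partition n) :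
    MvPolynomial (Fin N) R :=
  (p.parts.map fun k => esymm (Fin N) R k).prod

/-- The number of parts of a partition, i.e. `λ'_1`. -/
def numParts {n : ℕ} (p : Nat.Partition n) : ℕ := Multiset.card p.parts

/-- The largest part `λ_1` of a partition. -/
def maxPart {n : ℕ} (p : Nat.Partition n) : ℕ := p.parts.sup

/-- `λ'_1 + ⋯ + λ'_k`, the number of cells in the first `k` columns of `λ`. -/
def conjSum {n : ℕ} (p : Nat.Partition n) (k : ℕ) : ℕ :=
  (p.parts.map fun a => min a k).sum

/-- `λ_1 + ⋯ + λ_k`, the number of cells in the first `k` rows of `λ`. -/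
def partSum {n : ℕ} (p : Nat.Partition n) (k : ℕ) : ℕ :=
  ∑ j ∈ Finset.Icc 1 n, min (Multiset.card (p.parts.filter fun a => j ≤ a)) k

/-- `s` is an independent set of vertices of `G`. -/
def IsIndepFinset {V : Type} (G : SimpleGraph V) (s : Finset V) : Prop :=
  ∀ i ∈ s, ∀ j ∈ s, ¬ G.Adj i j

/-- `s` is a clique of `G`. -/
def IsCliqueFinset {V : Type} (G : SimpleGraph V) (s : Finset V) : Prop :=
  ∀ i ∈ s, ∀ j ∈ s, i ≠ j → G.Adj i j

/-- The independence number `α(G)`. -/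
def indepNum {n : ℕ} (G : SimpleGraph (Fin n)) : ℕ :=
  sSup {k | ∃ s : Finset (Fin n), IsIndepFinset G s ∧ s.card = k}

/-- The clique number `ω(G)`. -/
def cliqueNum {n : ℕ} (G : SimpleGraph (Fin n)) : ℕ :=
  sSup {k | ∃ s : Finset (Fin n), IsCliqueFinset G s ∧ s.card = k}

/-- `α_k(G)`: the maximum number of vertices in an independent partition
with `k` blocks. -/
def alphaK {n : ℕ} (G : SimpleGraph (Fin n)) (k : ℕ) : ℕ :=
  sSup {m | ∃ B : Fin k → Finset (Fin n),
    (∀ i j, i ≠ j → Disjoint (B i) (B j)) ∧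
    (∀ i, IsIndepFinset G (B i)) ∧ m = ∑ i, (B i).card}

/-- `ω_k(G)`: the maximum number of vertices in a clique partition
with `k` blocks. -/
def omegaK {n : ℕ} (G : SimpleGraph (Fin n)) (k : ℕ) : ℕ :=
  sSup {m | ∃ B : Fin k → Finset (Fin n),
    (∀ i j, i ≠ j → Disjoint (B i) (B j)) ∧
    (∀ i, IsCliqueFinset G (B i)) ∧ m = ∑ i, (B i).card}

/-- The `q`-factorial `[k]_q!` in `ℤ[q]`. -/
def qFact : ℕ → Polynomial ℤ
  | 0 => 1
  | k + 1 => qInt (k + 1) * qFact k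

end

/-- `e` lists the vertices of `G` in a perfect elimination order: the earlier
neighbours of each vertex form a clique. -/
def IsPEO {n : ℕ} (G : SimpleGraph (Fin n)) (e : Equiv.Perm (Fin n)) : Prop :=
  ∀ k j j' : Fin n, j < k → j' < k → G.Adj (e j) (e k) → G.Adj (e j') (e k) →
    e j ≠ e j' → G.Adj (e j) (e j')

/-- `b_k`: the number of earlier neighbours of `v_k` in the order `e`. -/
noncomputable def peoB {n : ℕ} (G : SimpleGraph (Fin n)) (e : Equiv.Perm (Fin n)) (k : Fin n) : ℕ :=
  (Finset.univ.filter fun j : Fin n => j < k ∧ G.Adj (e j) (e k)).card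


/-- Valid colourings of the first `m` vertices, with colours in `S`. -/
def stOk {α : Type} (R : ℕ → ℕ → Prop) (S : Finset α) (m : ℕ) (f : Fin m → α) : Prop :=
  (∀ i, f i ∈ S) ∧ ∀ j k : Fin m, j < k → R j k → f j ≠ f k

theorem stOk_snoc {α : Type} (R : ℕ → ℕ → Prop) (S : Finset α) (m : ℕ) (g : Fin m → α) (a : α) :
    stOk R S (m + 1) (Fin.snoc (α := fun _ => α) g a) ↔
      stOk R S m g ∧ (a ∈ S ∧ ∀ j : Fin m, R j m → g j ≠ a) := by
  unfold stOk
  constructor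
  · rintro ⟨h1, h2⟩
    refine ⟨⟨fun i => ?_, fun j k hjk hR => ?_⟩, ?_, fun j hR => ?_⟩
    · simpa using h1 i.castSucc
    · simpa using h2 j.castSucc k.castSucc (by simpa using hjk) (by simpa using hR)
    · simpa using h1 (Fin.last m)
    · simpa using h2 j.castSucc (Fin.last m) (Fin.castSucc_lt_last j) (by simpa using hR)
  · rintro ⟨⟨h1, h2⟩, h3, h4⟩
    refine ⟨fun i => ?_, fun j k hjk hR => ?_⟩
    · refine Fin.lastCases ?_ (fun i => ?_) i
      · simpa using h3
      · simpa using h1 i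
    · induction k using Fin.lastCases with
      | last =>
        induction j using Fin.lastCases with
        | last => exact absurd hjk (lt_irrefl _)
        | cast j => simpa using h4 j (by simpa using hR)
      | cast k =>
        induction j using Fin.lastCases with
        | last => exact absurd hjk (not_lt.mpr (Fin.le_last _))
        | cast j => simpa using h2 j k (by simpa using hjk) (by simpa using hR)

theorem stCount {α : Type} [Fintype α] (R : ℕ → ℕ → Prop)
    (hR : ∀ k j j', j < j' → j' < k → R j k → R j' k → R j j') (S : Finset α) (m : ℕ) :
    (∑ f : Fin m → α, if stOk R S m f then (1 : ℚ) else 0) =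
      ∏ k ∈ range m, ((S.card : ℚ) - ((range k).filter fun j => R j k).card) := by
  induction m with
  | zero => simp [stOk]
  | succ m ih =>
    rw [Finset.prod_range_succ, ← ih, ← (Fin.snocEquiv (fun _ => α)).sum_comp,
      Fintype.sum_prod_type_right, Finset.sum_mul]
    refine Finset.sum_congr rfl fun g _ => ?_
    have : ∀ a, stOk R S (m + 1) ((Fin.snocEquiv (fun _ => α)) (a, g)) ↔
      stOk R S m g ∧ (a ∈ S ∧ ∀ j : Fin m, R j m → g j ≠ a) := fun a => stOk_snoc R S m g a
    simp only [this]
    by_cases hg : stOk R S m g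
    · simp only [hg, true_and, if_true, one_mul]
      set T : Finset (Fin m) := univ.filter fun j => R j m with hT
      have hinj : Set.InjOn g T := by
        intro i hi j hj hij
        simp only [hT, coe_filter, mem_univ, true_and, Set.mem_ofPred_eq] at hi hj
        rcases lt_trichotomy i j with h | h | h
        · exact absurd hij (hg.2 i j h (hR m i j h j.2 hi hj))
        · exact h
        · exact absurd hij.symm (hg.2 j i h (hR m j i h i.2 hj hi))
      have hcard : ((range m).filter fun j => R j m).card = T.card := by
        rw [← Finset.card_map Fin.valEmbedding]
        congr 1
        ext x
        simp only [hT, mem_filter, mem_range, mem_map, mem_univ, true_and, Fin.valEmbedding_apply]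
        constructor
        · rintro ⟨h1, h2⟩
          exact ⟨⟨x, h1⟩, h2, rfl⟩
        · rintro ⟨a, h, rfl⟩
          exact ⟨a.2, h⟩
      have hsub : T.image g ⊆ S := by
        intro x hx
        obtain ⟨i, _, rfl⟩ := Finset.mem_image.mp hx
        exact hg.1 i
      have hset : (univ.filter fun a => a ∈ S ∧ ∀ j : Fin m, R j m → g j ≠ a) = S \ T.image g := by
        ext a
        simp [hT]
      rw [Finset.sum_boole, hset, Finset.card_sdiff_of_subset hsub,
        Nat.cast_sub (Finset.card_le_card hsub), Finset.card_image_of_injOn hinj, hcard]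
    · simp [hg]

theorem esymm_eval_ind (N k q : ℕ) (hq : q ≤ N) :
    aeval (fun i : Fin N => if (i : ℕ) < q then (1 : ℚ) else 0) (esymm (Fin N) ℤ k)
      = (q.choose k : ℚ) := by
  have hS : (univ.filter fun i : Fin N => (i : ℕ) < q).card = q := by
    rw [Fin.card_filter_val_lt]; exact min_eq_right hq
  rw [esymm, map_sum]
  simp only [map_prod, aeval_X, Finset.prod_ite_zero, Finset.prod_const_one]
  rw [Finset.sum_boole]
  congr 1
  conv_rhs => rw [← hS, ← Finset.card_powersetCard]
  congr 1
  ext t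
  simp only [mem_filter, mem_powersetCard, true_and, subset_iff, mem_univ]
  tauto

/-- The polynomial `binom(X, k)`. -/
noncomputable def binPoly (k : ℕ) : Polynomial ℚ :=
  Polynomial.C ((k.factorial : ℚ)⁻¹) * descPochhammer ℚ k

theorem binPoly_eval (k q : ℕ) : (binPoly k).eval (q : ℚ) = (q.choose k : ℚ) := by
  rw [binPoly, Nat.cast_choose_eq_descPochhammer_div]
  simp
  ring

theorem binPoly_natDegree (k : ℕ) : (binPoly k).natDegree ≤ k := by
  refine (Polynomial.natDegree_C_mul_le _ _).trans ?_
  rw [descPochhammer_natDegree]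

theorem binPoly_dvd (k : ℕ) (hk : k ≠ 0) : Polynomial.X ∣ binPoly k := by
  obtain ⟨k, rfl⟩ := Nat.exists_eq_succ_of_ne_zero hk
  rw [binPoly, Nat.succ_eq_add_one, descPochhammer_succ_left]
  exact Dvd.dvd.mul_left (Dvd.intro _ rfl) _

theorem desc_neg_one (k : ℕ) : (descPochhammer ℚ k).eval (-1) = (-1) ^ k * k.factorial := by
  induction k with
  | zero => simp
  | succ k ih =>
    rw [descPochhammer_succ_eval, ih, Nat.factorial_succ]
    push_cast
    ring

theorem binPoly_coeff (k : ℕ) : (binPoly (k + 1)).coeff 1 = (-1) ^ k / (k + 1 : ℚ) := by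
  rw [binPoly, descPochhammer_succ_left, Polynomial.coeff_C_mul, Polynomial.coeff_X_mul,
    Polynomial.coeff_zero_eq_eval_zero, Polynomial.eval_comp]
  simp only [Polynomial.eval_sub, Polynomial.eval_X, Polynomial.eval_one, zero_sub]
  rw [desc_neg_one, Nat.factorial_succ]
  have : (k.factorial : ℚ) ≠ 0 := by exact_mod_cast k.factorial_ne_zero
  have : (k + 1 : ℚ) ≠ 0 := by positivity
  push_cast
  field_simp

theorem prod_coeff_one_eq_zero (s : Multiset ℕ) (h0 : ∀ x ∈ s, x ≠ 0)
    (h : 2 ≤ Multiset.card s) : ((s.map binPoly).prod).coeff 1 = 0 := by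
  have h1 : ∀ t : Multiset ℕ, (∀ x ∈ t, x ≠ 0) →
      Polynomial.X ^ (Multiset.card t) ∣ (t.map binPoly).prod := by
    intro t
    induction t using Multiset.induction_on with
    | empty => simp
    | cons a t ih =>
      intro ht
      rw [Multiset.card_cons, Multiset.map_cons, Multiset.prod_cons, pow_succ']
      exact mul_dvd_mul (binPoly_dvd a (ht a (by simp)))
        (ih fun x hx => ht x (by simp [hx]))
  exact Polynomial.X_pow_dvd_iff.mp (h1 s h0) 1 (by omega)

theorem chrom_eval (n N q : ℕ) (hq : q ≤ N) (G : SimpleGraph (Fin n))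
    (e : Equiv.Perm (Fin n)) (hpeo : IsPEO G e) :
    aeval (fun i : Fin N => if (i : ℕ) < q then (1 : ℚ) else 0) (chromSym n N G) =
      ∏ k : Fin n, ((q : ℚ) - peoB G e k) := by
  obtain ⟨R, hRdef⟩ : ∃ R : ℕ → ℕ → Prop, R = fun j k =>
    ∃ (hj : j < n) (hk : k < n), G.Adj (e ⟨j, hj⟩) (e ⟨k, hk⟩) := ⟨_, rfl⟩
  set S : Finset (Fin N) := univ.filter fun i : Fin N => (i : ℕ) < q with hSdef
  have hS : S.card = q := by
    rw [hSdef, Fin.card_filter_val_lt]; exact min_eq_right hq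
  have hR : ∀ k j j', j < j' → j' < k → R j k → R j' k → R j j' := by
    subst hRdef
    rintro k j j' h1 h2 ⟨hj, hk, h3⟩ ⟨hj', _, h4⟩
    refine ⟨hj, hj', hpeo ⟨k, hk⟩ ⟨j, hj⟩ ⟨j', hj'⟩ (h1.trans h2) h2 h3 h4 ?_⟩
    intro h
    have := e.injective h
    simp only [Fin.mk.injEq] at this
    omega
  have key := stCount R hR S n
  have hb : ∀ k : Fin n, ((range k).filter fun j => R j k).card = peoB G e k := by
    intro k
    rw [peoB, ← Finset.card_map Fin.valEmbedding]
    congr 1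
    ext x
    simp only [mem_filter, mem_range, mem_map, mem_univ, true_and, Fin.valEmbedding_apply, hRdef]
    constructor
    · rintro ⟨h1, hj, hk, h2⟩
      exact ⟨⟨x, hj⟩, ⟨h1, h2⟩, rfl⟩
    · rintro ⟨a, ⟨h1, h2⟩, rfl⟩
      exact ⟨h1, a.2, k.2, h2⟩
  rw [← Fin.prod_univ_eq_prod_range
    (fun k => ((S.card : ℚ) - ((range k).filter fun j => R j k).card))] at key
  simp only [hb, hS] at key
  rw [← key, chromSym, map_sum, ← (Equiv.arrowCongr e (Equiv.refl (Fin N))).sum_comp]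
  refine Finset.sum_congr rfl fun f _ => ?_
  have hiff : stOk R S n f ↔ IsProper G ((Equiv.arrowCongr e (Equiv.refl (Fin N))) f) ∧
      ∀ i, ((f i : Fin N) : ℕ) < q := by
    constructor
    · rintro ⟨h1, h2⟩
      refine ⟨?_, fun i => by simpa [hSdef] using h1 i⟩
      intro i j hij
      simp only [Equiv.arrowCongr_apply, Function.comp_apply, Equiv.refl_apply]
      rcases lt_trichotomy (e.symm i) (e.symm j) with h | h | h
      · exact h2 _ _ h (by rw [hRdef]; exact ⟨(e.symm i).2, (e.symm j).2, by simpa using hij⟩)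
      · exact absurd (e.symm.injective h) hij.ne
      · exact (h2 _ _ h (by rw [hRdef]; exact ⟨(e.symm j).2, (e.symm i).2, by simpa using hij.symm⟩)).symm
    · rintro ⟨h1, h2⟩
      refine ⟨fun i => by simpa [hSdef] using h2 i, ?_⟩
      intro j k hjk hjk'
      rw [hRdef] at hjk'
      obtain ⟨_, _, h⟩ := hjk'
      simpa using h1 _ _ h
  by_cases hP : IsProper G ((Equiv.arrowCongr e (Equiv.refl (Fin N))) f)
  · simp only [hP, if_true, hiff, true_and, map_prod, aeval_X]
    rw [← Equiv.prod_comp e]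
    simp [Finset.prod_ite_zero]
  · simp [hP, hiff]

/-- for a graph with a perfect elimination order, the
coefficient of `e_n` in `X_G(x)` is `n · b_2 ⋯ b_n`. -/
theorem stmt17 (n N : ℕ) (hN : n ≤ N) (G : SimpleGraph (Fin n))
    (e : Equiv.Perm (Fin n)) (hpeo : IsPEO G e)
    (c : Nat.Partition n → ℤ)
    (hc : chromSym n N G = ∑ p : Nat.Partition n, C (c p) * eProd N ℤ p)
    (p : Nat.Partition n) (hp : p.parts = {n}) :
    c p = (n : ℤ) * ∏ k ∈ Finset.univ.filter (fun k : Fin n => 1 ≤ (k : ℕ)),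
      (peoB G e k : ℤ) := by
  have hn : n ≠ 0 := by
    rintro rfl
    exact absurd (p.parts_pos (i := 0) (by rw [hp]; simp)) (lt_irrefl _)
  obtain ⟨m, rfl⟩ : ∃ m, n = m + 1 := Nat.exists_eq_succ_of_ne_zero hn
  set A : Polynomial ℚ := ∏ k : Fin (m + 1), (Polynomial.X - Polynomial.C (peoB G e k : ℚ)) with hA
  set B : Polynomial ℚ := ∑ p : Nat.Partition (m + 1),
    Polynomial.C (c p : ℚ) * (p.parts.map binPoly).prod with hB
  have hAB : A = B := by
    apply Polynomial.eq_of_natDegree_lt_card_of_eval_eq A B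
      (ι := Fin (m + 2)) (f := fun i => ((i : ℕ) : ℚ))
    · intro i j h
      exact Fin.ext (Nat.cast_injective (R := ℚ) h)
    · intro i
      have hi : (i : ℕ) ≤ N := by omega
      have h1 := chrom_eval (m + 1) N i hi G e hpeo
      rw [hc, map_sum] at h1
      rw [hA, hB, Polynomial.eval_prod, Polynomial.eval_finsetSum]
      simp only [Polynomial.eval_sub, Polynomial.eval_X, Polynomial.eval_C, Polynomial.eval_mul]
      rw [← h1]
      refine Finset.sum_congr rfl fun p _ => ?_
      rw [map_mul, aeval_C, eProd, map_multiset_prod, Polynomial.eval_multiset_prod,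
        Multiset.map_map, Multiset.map_map]
      congr 1
      congr 1
      refine Multiset.map_congr rfl fun k _ => ?_
      simp only [Function.comp_apply]
      rw [esymm_eval_ind N k i hi, binPoly_eval]
    · rw [Fintype.card_fin]
      have hAd : A.natDegree ≤ m + 1 := by
        refine (Polynomial.natDegree_prod_le _ _).trans ?_
        simp only [Polynomial.natDegree_X_sub_C]
        simp
      have hBd : B.natDegree ≤ m + 1 := by
        refine Polynomial.natDegree_sum_le_of_forall_le _ _ fun p _ => ?_
        refine (Polynomial.natDegree_C_mul_le _ _).trans ?_
        refine (Polynomial.natDegree_multiset_prod_le _).trans ?_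
        rw [Multiset.map_map]
        conv_rhs => rw [← p.parts_sum, ← Multiset.map_id p.parts]
        exact Multiset.sum_map_le_sum_map _ _ fun k _ => binPoly_natDegree k
      exact lt_of_le_of_lt (max_le hAd hBd) (by omega)
  have hb0 : peoB G e 0 = 0 := by simp [peoB]
  have hA1 : A.coeff 1 = (-1) ^ m * ∏ k : Fin m, (peoB G e k.succ : ℚ) := by
    rw [hA, Fin.prod_univ_succ, hb0]
    simp only [Nat.cast_zero, map_zero, sub_zero]
    rw [Polynomial.coeff_X_mul, Polynomial.coeff_zero_eq_eval_zero, Polynomial.eval_prod]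
    simp [Finset.prod_neg]
  have hB1 : B.coeff 1 = c p * ((-1) ^ m / (m + 1 : ℚ)) := by
    rw [hB, Polynomial.finsetSum_coeff, Finset.sum_eq_single p]
    · rw [Polynomial.coeff_C_mul, hp]
      simp [binPoly_coeff]
    · intro p' _ hne
      rw [Polynomial.coeff_C_mul, prod_coeff_one_eq_zero, mul_zero]
      · intro x hx
        exact (p'.parts_pos hx).ne'
      · by_contra hlt
        have hcard : Multiset.card p'.parts = 0 ∨ Multiset.card p'.parts = 1 := by omega
        have hsum := p'.parts_sum
        rcases hcard with h | h
        · rw [Multiset.card_eq_zero] at h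
          rw [h] at hsum
          simp at hsum
        · obtain ⟨a, ha⟩ := Multiset.card_eq_one.mp h
          rw [ha, Multiset.sum_singleton] at hsum
          apply hne
          ext1
          rw [ha, hp, hsum]
    · simp
  have hfin : (c p : ℚ) = (m + 1 : ℚ) * ∏ k : Fin m, (peoB G e k.succ : ℚ) := by
    have h := hB1
    rw [← hAB, hA1] at h
    have h1 : (m + 1 : ℚ) ≠ 0 := by positivity
    have h2 : ((-1 : ℚ)) ^ m ≠ 0 := pow_ne_zero _ (by norm_num)
    apply mul_left_cancel₀ h2
    field_simp at h
    linear_combination -(-1 : ℚ) ^ m * h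
  have hprod : ∏ k ∈ Finset.univ.filter (fun k : Fin (m + 1) => 1 ≤ (k : ℕ)), (peoB G e k : ℤ)
      = ∏ k : Fin m, (peoB G e k.succ : ℤ) := by
    rw [Finset.prod_filter, Fin.prod_univ_succ]
    simp
  rw [hprod]
  exact_mod_cast hfin
end
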